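/- arXiv:2205.04106 — 3 statements merged into one kernel-verified Lean document; each statement's English description precedes it below -/
import Mathlib

section
/- Let n ≥ 1 and let f be a Schwartz function on ℂ^n × ℝ which is radial in z (i.e. f(z,s) depends only on (|z|,s)). Assume Σ_{m∈ℕ} binom(m+n-1,m) ∫_ℝ |f̂(m,λ)| |λ|^n dλ < ∞. Then for every (z,s) ∈ ℂ^n × ℝ one has the inversion formula f(z,s) = (2^{n-1}/π^{n+1}) Σ_{m=0}^∞ ∫_ℝ e^{-iλs} f̂(m,λ) L_m^{(n-1)}(2|λ||z|²) e^{-|λ||z|²} |λ|^n dλ, the series converging uniformly in (z,s). -/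
open MeasureTheory Filter

/-- Squared Euclidean norm of `z ∈ ℂⁿ`. -/
noncomputable def hnormSq {n : ℕ} (z : Fin n → ℂ) : ℝ := ∑ j, Complex.normSq (z j)

/-- Laguerre polynomial of type `d` and degree `m`. -/
noncomputable def laguerreL (d m : ℕ) (t : ℝ) : ℝ :=
  ∑ k ∈ Finset.range (m + 1),
    (-1 : ℝ) ^ k * (Nat.choose (m + d) (m - k)) * t ^ k / (Nat.factorial k)

/-- Spherical Fourier transform on the Heisenberg group `Hⁿ = ℂⁿ × ℝ`. -/
noncomputable def sphFT (n : ℕ) (f : (Fin n → ℂ) × ℝ → ℂ) (m : ℕ) (lam : ℝ) : ℂ :=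
  ((Nat.choose (m + n - 1) m : ℂ))⁻¹ *
    ∫ p : (Fin n → ℂ) × ℝ,
      Complex.exp (Complex.I * lam * p.2) * f p *
        ((laguerreL (n - 1) m (2 * |lam| * hnormSq p.1) *
          Real.exp (-(|lam| * hnormSq p.1)) : ℝ) : ℂ)


/-! ### Charlier polynomials and the Laguerre bound -/

lemma hasSum_of_eq {f g : ℕ → ℝ} {a b : ℝ} (h : HasSum f a) (hf : ∀ k, g k = f k) (hb : b = a) :
    HasSum g b := by
  rw [hb, funext hf]; exact h

noncomputable def chr (x : ℝ) : ℕ → ℕ → ℝ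
  | 0, _ => 1
  | (m+1), k => chr x m k - x * k * chr x m (k-1)

lemma chr_diff (x : ℝ) (m : ℕ) : ∀ k, chr x (m+1) (k+1) - chr x (m+1) k = -((m+1) * x) * chr x m k := by
  induction m with
  | zero => intro k; simp [chr]; ring
  | succ m ih =>
    intro k
    have h1 := ih k
    rw [chr.eq_2 x (k+1) (m+1), chr.eq_2 x k (m+1)]
    rcases k with _ | k
    · simp only [Nat.add_sub_cancel]
      push_cast
      linear_combination h1 + (m+1)*x * (by simp [chr] : chr x (m+1) 0 - chr x m 0 = 0)
    · have h2 := ih k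
      have h3 : chr x (m+1) (k+1) = chr x m (k+1) - x * (k+1) * chr x m k := by
        rw [chr]; simp
      simp only [Nat.add_sub_cancel]
      push_cast
      linear_combination h1 - x * (k+1) * h2 + (m+1) * x * h3

lemma chr_bound {x : ℝ} (hx : 0 ≤ x) (m : ℕ) : ∀ k : ℕ, |chr x m k| ≤ (1 + x * k) ^ m := by
  induction m with
  | zero => intro k; simp [chr]
  | succ m ih =>
    intro k
    rw [chr]
    have h1 := ih k
    have h2 : |chr x m (k-1)| ≤ (1 + x * k) ^ m := by
      refine (ih (k-1)).trans ?_
      have : ((k-1 : ℕ) : ℝ) ≤ k := by exact_mod_cast Nat.sub_le k 1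
      gcongr
    have h3 : 0 ≤ x * k := by positivity
    calc |chr x m k - x * k * chr x m (k-1)| ≤ |chr x m k| + |x * k * chr x m (k-1)| := abs_sub _ _
      _ = |chr x m k| + x * k * |chr x m (k-1)| := by rw [abs_mul, abs_of_nonneg h3]
      _ ≤ (1 + x * k) ^ m + x * k * (1 + x * k) ^ m := by gcongr
      _ = _ := by ring

lemma chr_summable {x t : ℝ} (hx : 0 ≤ x) (ht : 0 ≤ t) (N : ℕ) (a : ℕ → ℝ)
    (ha : ∀ k : ℕ, |a k| ≤ (1 + x * k) ^ N) :
    Summable fun k : ℕ => t ^ k / k.factorial * a k := by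
  refine Summable.of_norm_bounded (Real.summable_pow_div_factorial (t * Real.exp (x * N))) ?_
  intro k
  rw [Real.norm_eq_abs, abs_mul, abs_of_nonneg (by positivity : 0 ≤ t ^ k / (k.factorial:ℝ))]
  have h : |a k| ≤ (Real.exp (x * N)) ^ k := by
    refine (ha k).trans ?_
    have : 1 + x * k ≤ Real.exp (x * k) := by linarith [Real.add_one_le_exp (x * k)]
    calc (1 + x * k) ^ N ≤ (Real.exp (x * k)) ^ N := by gcongr
      _ = _ := by rw [← Real.exp_nat_mul, ← Real.exp_nat_mul]; ring_nf
  calc t ^ k / k.factorial * |a k| ≤ t ^ k / k.factorial * (Real.exp (x * N)) ^ k := by gcongr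
    _ = _ := by rw [mul_pow]; ring

lemma chr_norm {t : ℝ} (ht : 0 < t) (m : ℕ) :
    HasSum (fun k : ℕ => t ^ k / k.factorial * (chr t⁻¹ m k) ^ 2)
      (m.factorial * t⁻¹ ^ m * Real.exp t) := by
  have hx : (0:ℝ) ≤ t⁻¹ := by positivity
  have hb := fun m k => chr_bound hx m k
  have hge : ∀ k : ℕ, (1:ℝ) ≤ 1 + t⁻¹ * k := fun k => by
    have : 0 ≤ t⁻¹ * k := by positivity
    linarith
  induction m with
  | zero =>
    simp only [chr]
    have := NormedSpace.expSeries_div_hasSum_exp (𝔸 := ℝ) t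
    rw [← Real.exp_eq_exp_ℝ] at this
    simpa using this
  | succ m ih =>
    have s1 : Summable fun k : ℕ => t ^ k / k.factorial * (chr t⁻¹ (m+1) k * chr t⁻¹ m k) := by
      refine chr_summable hx ht.le ((m+1)+m) _ fun k => ?_
      rw [abs_mul, pow_add]
      have := hge k
      exact mul_le_mul (hb _ _) (hb _ _) (abs_nonneg _) (by positivity)
    have s2 : HasSum (fun k : ℕ => t ^ k / k.factorial * ((chr t⁻¹ (m+1) k - (-((m+1) * t⁻¹) * chr t⁻¹ m k + chr t⁻¹ (m+1) k))  * chr t⁻¹ m k))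
        ((m+1) * t⁻¹ * (m.factorial * t⁻¹ ^ m * Real.exp t)) := by
      refine hasSum_of_eq (ih.mul_left ((m+1) * t⁻¹)) (fun k => ?_) rfl
      ring
    have s3 : HasSum (fun k : ℕ => t ^ k / k.factorial * (chr t⁻¹ (m+1) (k+1) * chr t⁻¹ m k))
        ((∑' k : ℕ, t ^ k / k.factorial * (chr t⁻¹ (m+1) k * chr t⁻¹ m k)) - (m+1) * t⁻¹ * (m.factorial * t⁻¹ ^ m * Real.exp t)) := by
      refine hasSum_of_eq (s1.hasSum.sub s2) (fun k => ?_) rfl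
      have := chr_diff t⁻¹ m k
      rw [eq_add_of_sub_eq this]; ring
    have s4 : HasSum (fun k : ℕ => t ^ k / k.factorial * (t⁻¹ * k * (chr t⁻¹ (m+1) k * chr t⁻¹ m (k-1))))
        ((∑' k : ℕ, t ^ k / k.factorial * (chr t⁻¹ (m+1) k * chr t⁻¹ m k)) - (m+1) * t⁻¹ * (m.factorial * t⁻¹ ^ m * Real.exp t)) := by
      rw [← hasSum_nat_add_iff' 1]
      rw [show ∀ a : ℝ, a - ∑ i ∈ Finset.range 1, t ^ i / (i.factorial : ℝ) * (t⁻¹ * i * (chr t⁻¹ (m+1) i * chr t⁻¹ m (i-1))) = a by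
        intro a; simp]
      refine hasSum_of_eq s3 (fun k => ?_) rfl
      · rw [Nat.factorial_succ, Nat.add_sub_cancel]
        push_cast
        field_simp
        ring
    refine hasSum_of_eq (s1.hasSum.sub s4) (fun k => ?_) ?_
    · nth_rewrite 1 [pow_two]
      rw [chr]; ring
    · rw [Nat.factorial_succ]; push_cast; ring

lemma chr_explicit (x : ℝ) (m : ℕ) : ∀ k : ℕ, chr x m k =
    ∑ j ∈ Finset.range (m+1), (-1:ℝ)^j * m.choose j * k.descFactorial j * x ^ j := by
  induction m with
  | zero => intro k; simp [chr]
  | succ m ih =>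
    intro k
    rw [chr, ih, ih, Finset.sum_range_succ' _ (m+1)]
    rw [Finset.sum_range_succ' _ m]
    have h : ∀ j, (k:ℝ) * (k-1).descFactorial j = k.descFactorial (j+1) := by
      intro j
      rcases k with _ | k
      · simp
      · rw [Nat.succ_descFactorial_succ]; simp
    have e1 : ∑ j ∈ Finset.range m, (-1:ℝ)^(j+1) * m.choose (j+1) * k.descFactorial (j+1) * x ^ (j+1)
      = ∑ j ∈ Finset.range (m+1), (-1:ℝ)^(j+1) * m.choose (j+1) * k.descFactorial (j+1) * x ^ (j+1) := by
      rw [Finset.sum_range_succ]; simp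
    rw [e1, Finset.mul_sum, add_sub_right_comm, ← Finset.sum_sub_distrib]
    congr 1
    · refine Finset.sum_congr rfl fun j _ => ?_
      rw [← h j, Nat.choose_succ_succ]; push_cast; ring
    · simp

lemma chr_diag {t : ℝ} (ht : 0 < t) (m : ℕ) :
    t ^ m * chr t⁻¹ m m = (-1) ^ m * m.factorial * laguerreL 0 m t := by
  rw [chr_explicit, laguerreL, ← Finset.sum_range_reflect, Finset.mul_sum, Finset.mul_sum]
  refine Finset.sum_congr rfl fun k hk => ?_
  have hk : k ≤ m := by simpa [Nat.lt_succ_iff] using hk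
  obtain ⟨j, rfl⟩ := Nat.exists_eq_add_of_le hk
  have e : k + j + 1 - 1 - k = j := by omega
  have e2 : k + j - k = j := by omega
  rw [e, e2]
  have h1 : ((k + j).descFactorial j : ℝ) = (k+j).factorial / k.factorial := by
    rw [eq_div_iff (by positivity)]
    have := Nat.factorial_mul_descFactorial (n := k+j) (k := j) (by omega)
    rw [show k + j - j = k by omega] at this
    rw [mul_comm]; exact_mod_cast this
  rw [h1, pow_add, pow_add]
  have h2 : (-1:ℝ)^k * (-1:ℝ)^k = 1 := by rw [← mul_pow]; simp
  simp only [add_zero, inv_pow]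
  field_simp
  linear_combination -((k+j).choose j : ℝ) * h2

lemma lag0_bound {t : ℝ} (ht : 0 ≤ t) (m : ℕ) : |laguerreL 0 m t| ≤ Real.exp (t/2) := by
  rcases ht.eq_or_lt with rfl | ht
  · have : laguerreL 0 m 0 = 1 := by
      rw [laguerreL, Finset.sum_eq_single 0]
      · simp
      · intro k _ hk; simp [hk]
      · simp
    rw [this]; simp
  · apply abs_le_of_sq_le_sq _ (Real.exp_pos _).le
    rw [← Real.exp_nat_mul]
    have h := le_hasSum (chr_norm ht m) m (fun k _ => by positivity)
    have hd := chr_diag ht m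
    have hmm : (0:ℝ) < m.factorial := by positivity
    have h2 : (t ^ m * chr t⁻¹ m m)^2 ≤ m.factorial^2 * Real.exp t := by
      have : (t ^ m * chr t⁻¹ m m)^2 = (t ^ m * m.factorial) * (t ^ m / m.factorial * (chr t⁻¹ m m) ^ 2) := by
        field_simp
      rw [this]
      calc _ ≤ (t ^ m * m.factorial) * (m.factorial * t⁻¹ ^ m * Real.exp t) := by gcongr
        _ = _ := by rw [inv_pow]; field_simp
    rw [hd, mul_pow, mul_pow] at h2
    have h3 : ((-1:ℝ)^m)^2 = 1 := by rw [← pow_mul, mul_comm, pow_mul]; simp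
    rw [h3, one_mul] at h2
    have := le_of_mul_le_mul_left h2 (by positivity)
    simpa [mul_div_cancel₀] using this

lemma lag_rec (d m : ℕ) (t : ℝ) :
    laguerreL (d+1) (m+1) t = laguerreL (d+1) m t + laguerreL d (m+1) t := by
  unfold laguerreL
  rw [Finset.sum_range_succ _ (m+1), Finset.sum_range_succ _ (m+1), ← add_assoc (Finset.sum _ _) (Finset.sum _ _), ← Finset.sum_add_distrib]
  congr 1
  · refine Finset.sum_congr rfl fun k hk => ?_
    have hk : k ≤ m := by simpa [Nat.lt_succ_iff] using hk
    have e : m + 1 - k = (m - k) + 1 := by omega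
    have e2 : m + 1 + (d+1) = (m + (d + 1)) + 1 := by omega
    have e3 : m + 1 + d = m + (d+1) := by omega
    rw [e, e2, e3, Nat.choose_succ_succ]; push_cast; ring
  · simp

lemma lag_bound {t : ℝ} (ht : 0 ≤ t) (d : ℕ) : ∀ m, |laguerreL d m t| ≤ (m + d).choose m * Real.exp (t/2) := by
  induction d with
  | zero => intro m; simpa using lag0_bound ht m
  | succ d ih =>
    intro m
    induction m with
    | zero =>
      have : laguerreL (d+1) 0 t = 1 := by simp [laguerreL]
      rw [this]; simp; positivity
    | succ m ihm =>
      rw [lag_rec]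
      have e : ((m + 1 + (d+1)).choose (m+1) : ℝ) = (m + (d+1)).choose m + (m+1+d).choose (m+1) := by
        have e2 : m + 1 + (d+1) = (m + (d + 1)) + 1 := by omega
        have e3 : m + 1 + d = m + (d+1) := by omega
        rw [e2, e3, Nat.choose_succ_succ]; push_cast; ring
      rw [e, add_mul]
      exact (abs_add_le _ _).trans (add_le_add ihm (ih _))

/-! ### Generating function -/

lemma gen_fiber (d k : ℕ) {r : ℝ} (hr : |r| < 1) (t : ℝ) :
    HasSum (fun j : ℕ => (-1:ℝ)^k * t^k / k.factorial * (k+j+d).choose j * r^(k+j))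
      ((-(r*t/(1-r)))^k / k.factorial * (1 / (1-r)^(d+1))) := by
  have h := (hasSum_choose_mul_geometric_of_norm_lt_one (𝕜 := ℝ) (k+d) (r := r) hr).mul_left
    ((-1:ℝ)^k * t^k / k.factorial * r^k)
  have h1 : (1 - r) ≠ 0 := by
    have := (abs_lt.1 hr).2
    linarith
  refine hasSum_of_eq h (fun j => ?_) ?_
  · have : (k+j+d).choose j = (j + (k+d)).choose (k+d) := by
      rw [show k + j + d = j + (k+d) by omega, Nat.choose_symm_add]
    rw [this, pow_add]; ring
  · rw [neg_pow, div_pow, mul_pow]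
    have : (1-r)^(k+d+1) = (1-r)^k * (1-r)^(d+1) := by ring
    rw [this]
    field_simp

lemma gen_fun (d : ℕ) {r : ℝ} (hr : |r| < 1) (t : ℝ) :
    HasSum (fun m : ℕ => r^m * laguerreL d m t) (1 / (1-r)^(d+1) * Real.exp (-(r*t/(1-r)))) := by
  have hexp : ∀ x : ℝ, HasSum (fun k : ℕ => x^k / k.factorial) (Real.exp x) := fun x => by
    have := NormedSpace.expSeries_div_hasSum_exp (𝔸 := ℝ) x
    rwa [← Real.exp_eq_exp_ℝ] at this
  set a : ℕ × ℕ → ℝ := fun q => (-1:ℝ)^q.1 * t^q.1 / q.1.factorial * (q.1+q.2+d).choose q.2 * r^(q.1+q.2) with ha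
  have hs : Summable a := by
    rw [← summable_norm_iff]
    have hr' : |(|r|)| < 1 := by rwa [abs_abs]
    have hn : ∀ q : ℕ × ℕ, ‖a q‖ = (-1:ℝ)^q.1 * (-|t|)^q.1 / q.1.factorial * (q.1+q.2+d).choose q.2 * |r|^(q.1+q.2) := by
      intro q
      simp only [ha, Real.norm_eq_abs, abs_mul, abs_div, abs_pow, abs_neg, abs_one, Nat.abs_cast]
      rw [neg_pow |t|, ← mul_assoc ((-1:ℝ)^q.1) ((-1:ℝ)^q.1), ← mul_pow (-1:ℝ) (-1)]; norm_num only [one_pow, one_mul]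
    rw [summable_prod_of_nonneg (fun q => norm_nonneg _)]
    constructor
    · intro k
      refine (gen_fiber d k hr' (-|t|)).summable.congr fun j => ?_
      rw [hn]
    · refine ((hexp (-(|r| * (-|t|)/(1-|r|)))).mul_right (1 / (1-|r|)^(d+1))).summable.congr fun k => ?_
      rw [← (gen_fiber d k hr' (-|t|)).tsum_eq]
      exact tsum_congr fun j => (hn (k, j)).symm
  have h1 : HasSum a (Real.exp (-(r*t/(1-r))) * (1 / (1-r)^(d+1))) := by
    have h2 := hs.hasSum.prod_fiberwise (fun k => gen_fiber d k hr t)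
    have h3 := (hexp (-(r*t/(1-r)))).mul_right (1 / (1-r)^(d+1))
    rw [← h2.unique h3]
    exact hs.hasSum
  rw [mul_comm]
  have h4 := (Equiv.hasSum_iff Finset.HasAntidiagonal.sigmaAntidiagonalEquivProd).2 h1
  have h5 := h4.sigma (fun m => hasSum_fintype _)
  refine hasSum_of_eq h5 (fun m => ?_) rfl
  simp only [Function.comp, Finset.HasAntidiagonal.sigmaAntidiagonalEquivProd_apply]
  rw [Finset.sum_coe_sort (Finset.HasAntidiagonal.antidiagonal m) (fun q => a q), Finset.Nat.sum_antidiagonal_eq_sum_range_succ_mk,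
    laguerreL, Finset.mul_sum]
  refine Finset.sum_congr rfl fun k hk => ?_
  have hk : k ≤ m := by simpa [Nat.lt_succ_iff] using hk
  simp only [ha]
  rw [show k + (m - k) = m by omega]
  ring

/-! ### Gaussian moments -/

lemma hnormSq_nonneg {n : ℕ} (z : Fin n → ℂ) : 0 ≤ hnormSq z :=
  Finset.sum_nonneg fun _ _ => Complex.normSq_nonneg _

lemma hnormSq_cont {n : ℕ} : Continuous (hnormSq (n := n)) := by
  unfold hnormSq
  fun_prop

lemma gauss0 (n : ℕ) {p : ℝ} (hp : 0 < p) :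
    ∫ z : Fin n → ℂ, Real.exp (-(p * hnormSq z)) = Real.pi ^ n / p ^ n := by
  have h1 : ∀ z : Fin n → ℂ, Real.exp (-(p * hnormSq z)) = ∏ i, Real.exp (-p * ‖z i‖ ^ (2:ℝ)) := by
    intro z
    rw [← Real.exp_sum, hnormSq, Finset.mul_sum, ← Finset.sum_neg_distrib]
    congr 1
    refine Finset.sum_congr rfl fun i _ => ?_
    rw [Complex.normSq_eq_norm_sq, Real.rpow_two]; ring
  simp_rw [h1]
  have := integral_fintype_prod_volume_eq_pow (𝕜 := ℝ) (ι := Fin n) (fun x : ℂ => Real.exp (-p * ‖x‖ ^ (2:ℝ)))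
  rw [this, Complex.integral_exp_neg_mul_rpow (by norm_num) hp, Fintype.card_fin, ← div_pow]
  congr 1
  norm_num [Real.Gamma_two, Real.rpow_neg_one]
  rfl

lemma gauss_int0 (n : ℕ) {p : ℝ} (hp : 0 < p) :
    Integrable fun z : Fin n → ℂ => Real.exp (-(p * hnormSq z)) := by
  by_contra h
  have h1 := gauss0 n hp
  rw [integral_undef h] at h1
  have : 0 < Real.pi ^ n / p ^ n := by positivity
  linarith

lemma gauss_int (n k : ℕ) {p : ℝ} (hp : 0 < p) :
    Integrable fun z : Fin n → ℂ => hnormSq z ^ k * Real.exp (-(p * hnormSq z)) := by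
  have h := (gauss_int0 n (half_pos hp)).const_mul (k.factorial / (p/2)^k)
  refine h.mono' ?_ (Eventually.of_forall fun z => ?_)
  · have := hnormSq_cont (n := n)
    exact Continuous.aestronglyMeasurable (by fun_prop)
  · have hz := hnormSq_nonneg z
    rw [Real.norm_of_nonneg (by positivity)]
    have h2 := Real.pow_div_factorial_le_exp (p/2 * hnormSq z) (by positivity) k
    have h3 : hnormSq z ^ k ≤ k.factorial / (p/2)^k * Real.exp (p/2 * hnormSq z) := by
      rw [mul_pow, div_le_iff₀ (by positivity)] at h2
      rw [div_mul_eq_mul_div, le_div_iff₀ (by positivity)]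
      linarith
    calc hnormSq z ^ k * Real.exp (-(p * hnormSq z))
        ≤ (k.factorial / (p/2)^k * Real.exp (p/2 * hnormSq z)) * Real.exp (-(p * hnormSq z)) := by gcongr
      _ = _ := by rw [mul_assoc, ← Real.exp_add]; ring_nf

lemma gauss_mom (d k : ℕ) : ∀ {p : ℝ}, 0 < p →
    ∫ z : Fin (d+1) → ℂ, hnormSq z ^ k * Real.exp (-(p * hnormSq z))
      = Real.pi ^ (d+1) * ((d+k).factorial / d.factorial) / p ^ (d+1+k) := by
  induction k with
  | zero =>
    intro p hp
    simp only [pow_zero, one_mul, add_zero]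
    rw [gauss0 _ hp, div_self (by positivity), mul_one]
  | succ k ih =>
    intro p hp
    have hc := hnormSq_cont (n := d+1)
    have h := hasDerivAt_integral_of_dominated_loc_of_deriv_le (μ := volume) (𝕜 := ℝ) (E := ℝ)
      (F := fun q (z : Fin (d+1) → ℂ) => hnormSq z ^ k * Real.exp (-(q * hnormSq z)))
      (F' := fun q z => -(hnormSq z ^ (k+1) * Real.exp (-(q * hnormSq z))))
      (bound := fun z => hnormSq z ^ (k+1) * Real.exp (-(p/2 * hnormSq z)))
      (x₀ := p) (s := Set.Ioi (p/2)) (Ioi_mem_nhds (by linarith))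
      (Eventually.of_forall fun q => Continuous.aestronglyMeasurable (by fun_prop))
      (gauss_int (d+1) k hp) (Continuous.aestronglyMeasurable (by fun_prop))
      (Eventually.of_forall fun z q hq => by
        have hz := hnormSq_nonneg z
        have hq : p/2 < q := hq
        rw [norm_neg, Real.norm_of_nonneg (by positivity)]
        gcongr)
      (gauss_int (d+1) (k+1) (half_pos hp))
      (Eventually.of_forall fun z q hq => by
        have h1 : HasDerivAt (fun q : ℝ => -(q * hnormSq z)) (-(1 * hnormSq z)) q :=
          ((hasDerivAt_id q).mul_const _).neg
        have := (h1.exp).const_mul (hnormSq z ^ k)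
        refine this.congr_deriv ?_
        ring)
    have h1 := h.2
    rw [integral_neg] at h1
    have h2 : HasDerivAt (fun q : ℝ => Real.pi ^ (d+1) * ((d+k).factorial / d.factorial) / q ^ (d+1+k))
        (-(Real.pi ^ (d+1) * ((d+(k+1)).factorial / d.factorial) / p ^ (d+1+(k+1)))) p := by
      have h3 := ((hasDerivAt_pow (d+1+k) p).inv (by positivity)).const_mul (Real.pi ^ (d+1) * ((d+k).factorial / d.factorial))
      have e1 : (fun q : ℝ => Real.pi ^ (d+1) * ((d+k).factorial / d.factorial) / q ^ (d+1+k)) =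
        (fun q : ℝ => Real.pi ^ (d+1) * ((d+k).factorial / d.factorial) * (q ^ (d+1+k))⁻¹) := by
        funext q; rw [div_eq_mul_inv]
      rw [e1]
      refine h3.congr_deriv ?_
      rw [show d + (k+1) = (d+k)+1 by omega, Nat.factorial_succ, show d+1+k-1 = d+k by omega]
      push_cast
      have : p ^ (d+1+(k+1)) = p^(d+k) * p^2 := by ring
      have h5 : (p ^ (d+1+k))^2 = p^(d+k) * p^(d+k) * p^2 := by ring
      rw [this, h5]
      field_simp
      ring
    have h3 : HasDerivAt (fun q : ℝ => Real.pi ^ (d+1) * ((d+k).factorial / d.factorial) / q ^ (d+1+k))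
        (-∫ z : Fin (d+1) → ℂ, hnormSq z ^ (k+1) * Real.exp (-(p * hnormSq z))) p := by
      refine h1.congr_of_eventuallyEq ?_
      filter_upwards [Ioi_mem_nhds hp] with q hq
      exact (ih hq).symm
    exact neg_injective (h3.unique h2)

lemma lag_laplace (d m : ℕ) (a : ℝ) {p : ℝ} (hp : 0 < p) :
    ∫ z : Fin (d+1) → ℂ, laguerreL d m (2 * a * hnormSq z) * Real.exp (-(p * hnormSq z))
      = Real.pi ^ (d+1) / p ^ (d+1) * (m+d).choose m * (1 - 2 * a / p) ^ m := by
  have h1 : ∀ z : Fin (d+1) → ℂ, laguerreL d m (2 * a * hnormSq z) * Real.exp (-(p * hnormSq z)) =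
      ∑ k ∈ Finset.range (m+1), ((-1 : ℝ) ^ k * (Nat.choose (m + d) (m - k)) * (2*a) ^ k / (Nat.factorial k)) *
        (hnormSq z ^ k * Real.exp (-(p * hnormSq z))) := by
    intro z
    rw [laguerreL, Finset.sum_mul]
    refine Finset.sum_congr rfl fun k _ => ?_
    rw [mul_pow]; ring
  simp_rw [h1]
  rw [integral_finsetSum _ (fun k _ => (gauss_int _ _ hp).const_mul _)]
  simp_rw [integral_const_mul, gauss_mom d _ hp]
  rw [show (1 - 2 * a / p) = (-(2 * a / p)) + 1 by ring, add_pow, Finset.mul_sum]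
  refine Finset.sum_congr rfl fun k hk => ?_
  have hk : k ≤ m := by simpa [Nat.lt_succ_iff] using hk
  obtain ⟨j, rfl⟩ := Nat.exists_eq_add_of_le hk
  have e1 : k + j - k = j := by omega
  have c1 : ((k+j+d).choose j : ℝ) = (k+j+d).factorial / (j.factorial * (d+k).factorial) := by
    rw [show k + j + d = j + (d+k) by omega, Nat.cast_add_choose]
  have c2 : ((k+j+d).choose (k+j) : ℝ) = (k+j+d).factorial / ((k+j).factorial * d.factorial) := by
    rw [Nat.cast_add_choose]
  have c3 : ((k+j).choose k : ℝ) = (k+j).factorial / (k.factorial * j.factorial) := by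
    rw [Nat.cast_add_choose]
  rw [e1, c1, c2, c3, neg_pow (2*a/p), div_pow, one_pow, pow_add p (d+1) k]
  field_simp

/-! ### Uniqueness -/

lemma uniq_real (d : ℕ) (h : (Fin (d+1) → ℂ) → ℝ) (hc : Continuous h) (C : ℝ) (hb : ∀ z, |h z| ≤ C)
    (hrad : ∀ z z', hnormSq z = hnormSq z' → h z = h z')
    (hint : ∀ s : ℝ, 0 < s → ∫ z, h z * Real.exp (-(s * hnormSq z)) = 0) : ∀ z, h z = 0 := by
  have hN := hnormSq_cont (n := d+1)
  have hC : 0 ≤ C := (abs_nonneg _).trans (hb 0)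
  have hI : ∀ s : ℝ, 0 < s → Integrable fun z : Fin (d+1) → ℂ => h z * Real.exp (-(s * hnormSq z)) := by
    intro s hs
    exact (gauss_int0 (d+1) hs).bdd_mul hc.aestronglyMeasurable (Eventually.of_forall hb)
  have hpoly : ∀ P : Polynomial ℝ, ∫ z, h z * Real.exp (-(1 * hnormSq z)) * P.eval (Real.exp (-hnormSq z)) = 0 := by
    intro P
    have e : ∀ z : Fin (d+1) → ℂ, h z * Real.exp (-(1 * hnormSq z)) * P.eval (Real.exp (-hnormSq z))
        = ∑ i ∈ Finset.range (P.natDegree + 1), P.coeff i * (h z * Real.exp (-((i + 1 : ℝ) * hnormSq z))) := by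
      intro z
      rw [Polynomial.eval_eq_sum_range, Finset.mul_sum]
      refine Finset.sum_congr rfl fun i _ => ?_
      rw [← Real.exp_nat_mul]
      have : Real.exp (-((i + 1 : ℝ) * hnormSq z)) = Real.exp (-(1 * hnormSq z)) * Real.exp (i * -hnormSq z) := by
        rw [← Real.exp_add]; ring_nf
      rw [this]; ring
    simp_rw [e]
    rw [integral_finsetSum _ (fun i _ => (hI _ (by positivity)).const_mul _)]
    simp_rw [integral_const_mul]
    refine Finset.sum_eq_zero fun i _ => ?_
    rw [hint _ (by positivity), mul_zero]
  -- profile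
  set e0 : ℝ → (Fin (d+1) → ℂ) := fun u => Pi.single 0 ((Real.sqrt u : ℝ) : ℂ) with he0
  have he0c : Continuous e0 := by
    apply continuous_pi
    intro i
    by_cases hi : i = 0
    · subst hi; simp only [he0, Pi.single_eq_same]; fun_prop
    · simp only [he0, Pi.single_eq_of_ne hi]; fun_prop
  have he0n : ∀ u, 0 ≤ u → hnormSq (e0 u) = u := by
    intro u hu
    rw [hnormSq, Finset.sum_eq_single 0]
    · simp [he0, Complex.normSq_ofReal, Real.mul_self_sqrt hu]
    · intro j _ hj; simp [he0, Pi.single_eq_of_ne hj]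
    · simp
  set ψ : ℝ → ℝ := fun x => h (e0 (-Real.log x)) * x with hψ
  have hψc : Continuous ψ := by
    rw [continuous_iff_continuousAt]
    intro x
    by_cases hx : x = 0
    · subst hx
      unfold ContinuousAt
      have : ψ 0 = 0 := by simp [hψ]
      rw [this]
      refine squeeze_zero_norm (a := fun x => C * |x|) (fun x => ?_) ?_
      · simp only [hψ, norm_mul, Real.norm_eq_abs]
        gcongr
        exact hb _
      · have : Continuous fun x : ℝ => C * |x| := by fun_prop
        simpa using this.tendsto 0
    · exact (hc.continuousAt.comp (he0c.continuousAt.comp (Real.continuousAt_log hx).neg)).mul continuousAt_id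
  have hψv : ∀ z, ψ (Real.exp (-hnormSq z)) = h z * Real.exp (-(1 * hnormSq z)) := by
    intro z
    simp only [hψ, Real.log_exp, neg_neg, one_mul]
    congr 1
    exact hrad _ _ (he0n _ (hnormSq_nonneg z))
  have hI1 := hI 1 one_pos
  have hIψ : Integrable fun z : Fin (d+1) → ℂ => h z * Real.exp (-(1 * hnormSq z)) * ψ (Real.exp (-hnormSq z)) := by
    refine hI1.mul_bdd (c := C) ?_ (Eventually.of_forall fun z => ?_)
    · exact Continuous.aestronglyMeasurable (by fun_prop)
    · rw [hψv, norm_mul]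
      have h1 : ‖Real.exp (-(1 * hnormSq z))‖ ≤ 1 := by
        rw [Real.norm_of_nonneg (Real.exp_pos _).le, Real.exp_le_one_iff]
        have := hnormSq_nonneg z
        linarith
      calc _ ≤ C * 1 := mul_le_mul (hb z) h1 (norm_nonneg _) hC
        _ = C := mul_one _
  have hzero : ∫ z, h z * Real.exp (-(1 * hnormSq z)) * ψ (Real.exp (-hnormSq z)) = 0 := by
    rw [← abs_nonpos_iff]
    refine le_of_forall_pos_le_add fun ε hε => ?_
    rw [zero_add]
    set K := ∫ z, ‖h z * Real.exp (-(1 * hnormSq z))‖ with hK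
    have hK0 : 0 ≤ K := integral_nonneg fun _ => norm_nonneg _
    obtain ⟨P, hP⟩ := exists_polynomial_near_of_continuousOn 0 1 ψ hψc.continuousOn (ε / (K+1)) (by positivity)
    have hP' : ∀ z : Fin (d+1) → ℂ, |ψ (Real.exp (-hnormSq z)) - P.eval (Real.exp (-hnormSq z))| ≤ ε / (K+1) := by
      intro z
      rw [abs_sub_comm]
      refine (hP _ ⟨(Real.exp_pos _).le, ?_⟩).le
      rw [Real.exp_le_one_iff]
      linarith [hnormSq_nonneg z]
    have hId : Integrable fun z : Fin (d+1) → ℂ => h z * Real.exp (-(1 * hnormSq z)) *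
        (ψ (Real.exp (-hnormSq z)) - P.eval (Real.exp (-hnormSq z))) := by
      refine hI1.mul_bdd (c := ε / (K+1)) ?_ (Eventually.of_forall hP')
      have := P.continuous
      exact Continuous.aestronglyMeasurable (by fun_prop)
    have hIP : Integrable fun z : Fin (d+1) → ℂ => h z * Real.exp (-(1 * hnormSq z)) *
        P.eval (Real.exp (-hnormSq z)) := by
      refine (hIψ.sub hId).congr (Eventually.of_forall fun z => ?_)
      simp only [Pi.sub_apply]; ring
    have e1 : ∫ z, h z * Real.exp (-(1 * hnormSq z)) * ψ (Real.exp (-hnormSq z)) =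
        ∫ z, h z * Real.exp (-(1 * hnormSq z)) * (ψ (Real.exp (-hnormSq z)) - P.eval (Real.exp (-hnormSq z))) := by
      simp_rw [mul_sub]
      rw [integral_sub hIψ hIP, hpoly P, sub_zero]
    rw [e1]
    calc _ ≤ ∫ z, ‖h z * Real.exp (-(1 * hnormSq z))‖ * (ε / (K+1)) := by
          rw [← Real.norm_eq_abs]
          refine (norm_integral_le_integral_norm _).trans ?_
          refine integral_mono hId.norm (hI1.norm.mul_const _) fun z => ?_
          simp only
          rw [norm_mul _ (ψ _ - _)]
          exact mul_le_mul_of_nonneg_left (hP' z) (norm_nonneg _)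
      _ = K * (ε / (K+1)) := by rw [integral_mul_const]
      _ ≤ ε := by
        rw [mul_div_assoc', div_le_iff₀ (by positivity)]
        nlinarith
  simp_rw [hψv] at hzero hIψ
  have h2 := (integral_eq_zero_iff_of_nonneg (fun z => mul_self_nonneg _) hIψ).1 hzero
  have hcc : Continuous fun z : Fin (d+1) → ℂ => h z * Real.exp (-(1 * hnormSq z)) := by fun_prop
  have h3 := (Continuous.ae_eq_iff_eq (volume : Measure (Fin (d+1) → ℂ)) (hcc.mul hcc) continuous_const).1 h2
  intro z
  have h4 : h z * Real.exp (-(1 * hnormSq z)) * (h z * Real.exp (-(1 * hnormSq z))) = 0 := congrFun h3 z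
  exact (mul_eq_zero.1 (mul_self_eq_zero.1 h4)).resolve_right (Real.exp_pos _).ne'

lemma uniq_cplx (d : ℕ) (h : (Fin (d+1) → ℂ) → ℂ) (hc : Continuous h) (C : ℝ) (hb : ∀ z, ‖h z‖ ≤ C)
    (hrad : ∀ z z', hnormSq z = hnormSq z' → h z = h z')
    (hint : ∀ s : ℝ, 0 < s → ∫ z, h z * (Real.exp (-(s * hnormSq z)) : ℂ) = 0) : ∀ z, h z = 0 := by
  have hI : ∀ s : ℝ, 0 < s → Integrable fun z : Fin (d+1) → ℂ => h z * (Real.exp (-(s * hnormSq z)) : ℂ) := by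
    intro s hs
    exact ((gauss_int0 (d+1) hs).ofReal (𝕜 := ℂ)).bdd_mul hc.aestronglyMeasurable (Eventually.of_forall hb)
  have hre := uniq_real d (fun z => (h z).re) (by fun_prop) C (fun z => (Complex.abs_re_le_norm _).trans (hb z))
    (fun z z' hz => by simp only [hrad z z' hz]) (fun s hs => by
      have := congrArg Complex.re (hint s hs)
      rw [← RCLike.re_eq_complex_re, ← integral_re (hI s hs)] at this
      simpa only [RCLike.re_eq_complex_re, Complex.re_mul_ofReal, Complex.zero_re] using this)
  have him := uniq_real d (fun z => (h z).im) (by fun_prop) C (fun z => (Complex.abs_im_le_norm _).trans (hb z))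
    (fun z z' hz => by simp only [hrad z z' hz]) (fun s hs => by
      have := congrArg Complex.im (hint s hs)
      rw [← RCLike.im_eq_complex_im, ← integral_im (hI s hs)] at this
      simpa only [RCLike.im_eq_complex_im, Complex.im_mul_ofReal, Complex.zero_im] using this)
  intro z
  exact Complex.ext (hre z) (him z)

/-! ### The operator TT -/

instance haarProd (n : ℕ) : (volume : Measure ((Fin n → ℂ) × ℝ)).IsAddHaarMeasure := by
  have : (volume : Measure (Fin n → ℂ)).IsAddHaarMeasure := inferInstance
  exact Measure.prod.instIsAddHaarMeasure _ _

instance tempProd (n : ℕ) : (volume : Measure ((Fin n → ℂ) × ℝ)).HasTemperateGrowth := by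
  infer_instance

noncomputable def TT {n : ℕ} (f : (Fin n → ℂ) × ℝ → ℂ) (a : (Fin n → ℂ) → ℝ) (lam : ℝ) : ℂ :=
  ∫ p : (Fin n → ℂ) × ℝ, Complex.exp (Complex.I * lam * p.2) * f p * ((a p.1 : ℝ) : ℂ)

lemma norm_exp_I (x y : ℝ) : ‖Complex.exp (Complex.I * x * y)‖ = 1 := by
  rw [show Complex.I * x * y = ((x * y : ℝ) : ℂ) * Complex.I by push_cast; ring]
  exact Complex.norm_exp_ofReal_mul_I _

lemma norm_exp_negI (x y : ℝ) : ‖Complex.exp (-(Complex.I * x * y))‖ = 1 := by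
  rw [show -(Complex.I * x * y) = ((-(x * y) : ℝ) : ℂ) * Complex.I by push_cast; ring]
  exact Complex.norm_exp_ofReal_mul_I _

section
variable {n : ℕ} (f : SchwartzMap ((Fin n → ℂ) × ℝ) ℂ)

lemma TT_norm_le {a : (Fin n → ℂ) → ℝ} {C : ℝ} (hC : ∀ z, |a z| ≤ C) (lam : ℝ) (p : (Fin n → ℂ) × ℝ) :
    ‖Complex.exp (Complex.I * lam * p.2) * f p * ((a p.1 : ℝ) : ℂ)‖ ≤ C * ‖f p‖ := by
  rw [norm_mul, norm_mul, norm_exp_I, one_mul, Complex.norm_real, mul_comm]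
  exact mul_le_mul_of_nonneg_right (hC _) (norm_nonneg _)

lemma TT_int {a : (Fin n → ℂ) → ℝ} (ha : Continuous a) {C : ℝ} (hC : ∀ z, |a z| ≤ C) (lam : ℝ) :
    Integrable fun p : (Fin n → ℂ) × ℝ => Complex.exp (Complex.I * lam * p.2) * f p * ((a p.1 : ℝ) : ℂ) := by
  refine (f.integrable.norm.const_mul C).mono' ?_ (Eventually.of_forall (TT_norm_le f hC lam))
  have := f.continuous
  exact Continuous.aestronglyMeasurable (by fun_prop)

lemma TT_bound {a : (Fin n → ℂ) → ℝ} {C : ℝ} (hC : ∀ z, |a z| ≤ C) (lam : ℝ) :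
    ‖TT f a lam‖ ≤ C * ∫ p, ‖f p‖ := by
  rw [← integral_const_mul]
  exact norm_integral_le_of_norm_le (f.integrable.norm.const_mul C) (Eventually.of_forall (TT_norm_le f hC lam))

noncomputable def DD (f : SchwartzMap ((Fin n → ℂ) × ℝ) ℂ) : SchwartzMap ((Fin n → ℂ) × ℝ) ℂ :=
  LineDeriv.lineDerivOp ((0, 1) : (Fin n → ℂ) × ℝ) f

lemma TT_deriv {a : (Fin n → ℂ) → ℝ} (ha : Continuous a) {C : ℝ} (hC : ∀ z, |a z| ≤ C) (lam : ℝ) :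
    TT (DD f) a lam = -(Complex.I * lam) * TT f a lam := by
  have h := integral_bilinear_hasLineDerivAt_right_eq_neg_left_of_integrable
    (μ := (volume : Measure ((Fin n → ℂ) × ℝ))) (B := ContinuousLinearMap.mul ℝ ℂ)
    (f := fun p : (Fin n → ℂ) × ℝ => Complex.exp (Complex.I * lam * p.2) * ((a p.1 : ℝ) : ℂ))
    (f' := fun p : (Fin n → ℂ) × ℝ => (Complex.I * lam) * (Complex.exp (Complex.I * lam * p.2) * ((a p.1 : ℝ) : ℂ)))
    (g := f) (g' := DD f) (v := (0, 1)) ?_ ?_ ?_ ?_ ?_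
  · simp only [ContinuousLinearMap.mul_apply'] at h
    unfold TT
    rw [← integral_const_mul]
    calc _ = _ := by congr 1; funext p; ring
      _ = _ := h
      _ = _ := by rw [← integral_neg]; congr 1; funext p; ring
  · refine ((TT_int f ha hC lam).const_mul (Complex.I * lam)).congr (Eventually.of_forall fun p => ?_)
    simp only [ContinuousLinearMap.mul_apply']; ring
  · refine (TT_int (DD f) ha hC lam).congr (Eventually.of_forall fun p => ?_)
    simp only [ContinuousLinearMap.mul_apply']; ring
  · refine (TT_int f ha hC lam).congr (Eventually.of_forall fun p => ?_)
    simp only [ContinuousLinearMap.mul_apply']; ring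
  · intro p _
    unfold HasLineDerivAt
    have h1 : HasDerivAt (fun t : ℝ => Complex.I * lam * ((p.2 + t : ℝ) : ℂ)) (Complex.I * lam * 1) 0 := by
      apply HasDerivAt.const_mul
      have := ((hasDerivAt_id (0:ℝ)).const_add p.2).ofReal_comp
      simpa using this
    have h2 := (h1.cexp).mul_const ((a p.1 : ℝ) : ℂ)
    have e : (fun t : ℝ => Complex.exp (Complex.I * lam * (((p + t • ((0:Fin n → ℂ), (1:ℝ))).2 : ℝ) : ℂ)) * ((a (p + t • ((0:Fin n → ℂ), (1:ℝ))).1 : ℝ) : ℂ))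
        = fun t : ℝ => Complex.exp (Complex.I * lam * ((p.2 + t : ℝ) : ℂ)) * ((a p.1 : ℝ) : ℂ) := by
      funext t; simp
    rw [e]
    refine h2.congr_deriv ?_
    simp only [add_zero, mul_one]; ring
  · intro p _
    have := (f.differentiable p).hasFDerivAt.hasLineDerivAt ((0, 1) : (Fin n → ℂ) × ℝ)
    rw [← SchwartzMap.lineDerivOp_apply_eq_fderiv] at this
    exact this

lemma TT_deriv_iter {a : (Fin n → ℂ) → ℝ} (ha : Continuous a) {C : ℝ} (hC : ∀ z, |a z| ≤ C) (lam : ℝ) (k : ℕ) :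
    ‖TT (DD^[k] f) a lam‖ = |lam| ^ k * ‖TT f a lam‖ := by
  induction k with
  | zero => simp
  | succ k ih =>
    rw [Function.iterate_succ_apply', TT_deriv _ ha hC, norm_mul, ih]
    simp; ring

lemma TT_decay (k : ℕ) : ∃ K : ℝ, ∀ (a : (Fin n → ℂ) → ℝ), Continuous a → ∀ C : ℝ, (∀ z, |a z| ≤ C) →
    ∀ lam : ℝ, ‖TT f a lam‖ * |lam| ^ k ≤ C * K * (1 + lam ^ 2)⁻¹ := by
  refine ⟨(∫ p, ‖(DD^[k] f) p‖) + ∫ p, ‖(DD^[k+2] f) p‖, fun a ha C hC lam => ?_⟩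
  have h1 := TT_bound (DD^[k] f) hC lam
  have h2 := TT_bound (DD^[k+2] f) hC lam
  rw [TT_deriv_iter f ha hC] at h1 h2
  rw [← div_eq_mul_inv, le_div_iff₀ (by positivity)]
  have e : |lam| ^ (k+2) = |lam| ^ k * lam ^ 2 := by rw [pow_add, sq_abs]
  rw [e] at h2
  linarith

lemma TT_cont {a : ℝ → (Fin n → ℂ) → ℝ} (ha : Continuous (Function.uncurry a)) {C : ℝ} (hC : ∀ l z, |a l z| ≤ C) :
    Continuous fun lam => TT f (a lam) lam := by
  unfold TT
  have hf := f.continuous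
  have ha1 : ∀ l, Continuous (a l) := fun l => ha.comp (Continuous.prodMk_right l)
  refine continuous_of_dominated (bound := fun p => C * ‖f p‖) (fun l => (TT_int f (ha1 l) (hC l) l).aestronglyMeasurable)
    (fun l => Eventually.of_forall (TT_norm_le f (hC l) l)) (f.integrable.norm.const_mul C) (Eventually.of_forall fun p => ?_)
  have : Continuous fun l => a l p.1 := ha.comp (Continuous.prodMk_left p.1)
  fun_prop

lemma TT_inv {a : (Fin n → ℂ) → ℝ} (ha : Continuous a) {C : ℝ} (hC : ∀ z, |a z| ≤ C) (hi : Integrable a) (s : ℝ) :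
    ∫ lam : ℝ, Complex.exp (-(Complex.I * lam * s)) * TT f a lam = 2 * Real.pi * ∫ z, f (z, s) * ((a z : ℝ) : ℂ) := by
  have hf := f.continuous
  set q : ℝ → ℂ := fun s => ∫ z, f (z, s) * ((a z : ℝ) : ℂ) with hq
  have hqc : Continuous q := by
    refine continuous_of_dominated (bound := fun z => SchwartzMap.seminorm ℝ 0 0 f * |a z|)
      (fun s => Continuous.aestronglyMeasurable (by fun_prop)) (fun s => Eventually.of_forall fun z => ?_)
      (hi.abs.const_mul _) (Eventually.of_forall fun z => by fun_prop)
    rw [norm_mul, Complex.norm_real]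
    exact mul_le_mul_of_nonneg_right (SchwartzMap.norm_le_seminorm ℝ f _) (abs_nonneg _)
  have hqi : Integrable q := by
    have := TT_int f ha hC 0
    simp only [Complex.ofReal_zero, mul_zero, zero_mul, Complex.exp_zero, one_mul] at this
    exact this.integral_prod_right
  have hT : ∀ lam, TT f a lam = ∫ s : ℝ, Complex.exp (Complex.I * lam * s) * q s := by
    intro lam
    have := integral_prod_symm _ (TT_int f ha hC lam)
    unfold TT
    refine this.trans ?_
    congr 1
    funext s
    rw [hq, ← integral_const_mul]
    congr 1; funext z; ring
  have hF : ∀ w, FourierTransform.fourier q w = TT f a (-2 * Real.pi * w) := by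
    intro w
    rw [Real.fourier_real_eq_integral_exp_smul, hT]
    congr 1; funext v
    rw [smul_eq_mul]; push_cast; ring_nf
  have hTi : Integrable fun lam => TT f a lam := by
    obtain ⟨K, hK⟩ := TT_decay f 0
    refine (integrable_inv_one_add_sq.const_mul (C * K)).mono' ?_ (Eventually.of_forall fun lam => ?_)
    · exact (TT_cont f (a := fun _ => a) (by exact ha.comp continuous_snd) (fun _ => hC)).aestronglyMeasurable
    · simpa using hK a ha C hC lam
  have hpi : (-2 * Real.pi) ≠ 0 := by simp [Real.pi_ne_zero]
  have hFi : Integrable (FourierTransform.fourier q) := by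
    rw [show FourierTransform.fourier q = fun w => TT f a (-2 * Real.pi * w) from funext hF]
    exact hTi.comp_mul_left' hpi
  have hinv := congrFun (hqc.fourierInv_fourier_eq hqi hFi) s
  rw [Real.fourierInv_eq'] at hinv
  have h2 := Measure.integral_comp_mul_left (fun lam : ℝ => Complex.exp (-(Complex.I * lam * s)) * TT f a lam) (-2 * Real.pi)
  have h3 : ∫ x : ℝ, Complex.exp (-(Complex.I * ((-2 * Real.pi * x : ℝ) : ℂ) * s)) * TT f a (-2 * Real.pi * x) = q s := by
    rw [← hinv]
    congr 1; funext v
    rw [hF, smul_eq_mul]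
    congr 2
    simp only [RCLike.inner_apply, conj_trivial]
    push_cast; ring
  rw [h3] at h2
  change _ = 2 * Real.pi * q s
  rw [h2, Complex.real_smul]
  have : |(-2 * Real.pi)⁻¹| = (2 * Real.pi)⁻¹ := by
    rw [abs_inv, abs_mul, abs_of_pos Real.pi_pos]; norm_num
  rw [this]
  push_cast
  have : (Real.pi : ℂ) ≠ 0 := by exact_mod_cast Real.pi_ne_zero
  generalize (∫ lam : ℝ, Complex.exp (-(Complex.I * lam * s)) * TT f a lam) = J
  field_simp

end

/-! ### Spherical functions -/

noncomputable def ph (d m : ℕ) (lam : ℝ) (z : Fin (d + 1) → ℂ) : ℝ :=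
  laguerreL d m (2 * |lam| * hnormSq z) * Real.exp (-(|lam| * hnormSq z))

lemma laguerreL_cont (d m : ℕ) : Continuous (laguerreL d m) := by
  unfold laguerreL; fun_prop

lemma ph_cont (d m : ℕ) : Continuous (Function.uncurry (ph d m)) := by
  have h1 := laguerreL_cont d m
  have h2 : Continuous fun q : ℝ × (Fin (d + 1) → ℂ) => hnormSq q.2 := hnormSq_cont.comp continuous_snd
  have h3 : Continuous fun q : ℝ × (Fin (d + 1) → ℂ) => |q.1| := continuous_fst.abs
  change Continuous fun q : ℝ × (Fin (d + 1) → ℂ) =>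
    laguerreL d m (2 * |q.1| * hnormSq q.2) * Real.exp (-(|q.1| * hnormSq q.2))
  exact (h1.comp ((continuous_const.mul h3).mul h2)).mul (Real.continuous_exp.comp (h3.mul h2).neg)

lemma ph_cont1 (d m : ℕ) (lam : ℝ) : Continuous (ph d m lam) :=
  Continuous.comp (g := Function.uncurry (ph d m)) (f := fun z => (lam, z)) (ph_cont d m) (by fun_prop)

lemma ph_cont2 (d m : ℕ) (z : Fin (d + 1) → ℂ) : Continuous (fun lam => ph d m lam z) :=
  Continuous.comp (g := Function.uncurry (ph d m)) (f := fun lam => (lam, z)) (ph_cont d m) (by fun_prop)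

lemma ph_bound (d m : ℕ) (lam : ℝ) (z : Fin (d + 1) → ℂ) : |ph d m lam z| ≤ (m + d).choose m := by
  have h0 : 0 ≤ 2 * |lam| * hnormSq z := mul_nonneg (by positivity) (hnormSq_nonneg z)
  have h := lag_bound h0 d m
  unfold ph
  rw [abs_mul, abs_of_pos (Real.exp_pos _)]
  calc _ ≤ _ := mul_le_mul_of_nonneg_right h (Real.exp_pos _).le
    _ = _ := by
      rw [mul_assoc, ← Real.exp_add]
      rw [show 2 * |lam| * hnormSq z / 2 + -(|lam| * hnormSq z) = 0 by ring]; simp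

lemma hasSum_of_eqC {f g : ℕ → ℂ} {a b : ℂ} (h : HasSum f a) (hf : ∀ k, g k = f k) (hb : b = a) :
    HasSum g b := by
  rw [show g = f from funext hf, hb]; exact h

section
variable {d : ℕ} (f : SchwartzMap ((Fin (d + 1) → ℂ) × ℝ) ℂ)

lemma sph_eq (m : ℕ) (lam : ℝ) :
    sphFT (d + 1) f m lam = (((m + d).choose m : ℕ) : ℂ)⁻¹ * TT f (ph d m lam) lam := rfl

lemma sph_cont (m : ℕ) : Continuous fun lam => sphFT (d + 1) f m lam := by
  simp only [sph_eq]
  exact continuous_const.mul (TT_cont f (ph_cont d m) (ph_bound d m))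

lemma sph_int (m : ℕ) : Integrable fun lam : ℝ => ‖sphFT (d + 1) f m lam‖ * |lam| ^ (d + 1) := by
  obtain ⟨K, hK⟩ := TT_decay f (d + 1)
  refine (integrable_inv_one_add_sq.const_mul (‖(((m + d).choose m : ℕ) : ℂ)⁻¹‖ * ((m + d).choose m * K))).mono' ?_
    (Eventually.of_forall fun lam => ?_)
  · exact ((sph_cont f m).norm.mul (continuous_abs.pow _)).aestronglyMeasurable
  · rw [Real.norm_of_nonneg (by positivity), sph_eq, norm_mul, mul_assoc, mul_assoc]
    exact mul_le_mul_of_nonneg_left (hK _ (ph_cont1 d m lam) _ (ph_bound d m lam) lam) (norm_nonneg _)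

lemma rr_lt {lam sg : ℝ} (hl : lam ≠ 0) (hs : 0 < sg) : |1 - 2 * |lam| / (|lam| + sg)| < 1 := by
  have h := abs_pos.mpr hl
  rw [abs_lt]
  constructor
  · have : 2 * |lam| / (|lam| + sg) < 2 := by rw [div_lt_iff₀ (by positivity)]; nlinarith
    linarith
  · have : 0 < 2 * |lam| / (|lam| + sg) := by positivity
    linarith

lemma gen_TT {lam sg : ℝ} (hl : lam ≠ 0) (hs : 0 < sg) :
    HasSum (fun m : ℕ => (((1 - 2 * |lam| / (|lam| + sg)) ^ m : ℝ) : ℂ) * TT f (ph d m lam) lam)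
      (((1 / (2 * |lam| / (|lam| + sg)) ^ (d + 1) : ℝ) : ℂ) *
        TT f (fun z => Real.exp (-(sg * hnormSq z))) lam) := by
  set r : ℝ := 1 - 2 * |lam| / (|lam| + sg) with hr
  have hr1 : |r| < 1 := rr_lt hl hs
  have hl0 := abs_pos.mpr hl
  have hsumm : Summable fun m : ℕ => |r| ^ m * ((m + d).choose m : ℝ) := by
    have := summable_choose_mul_geometric_of_norm_lt_one (R := ℝ) d (r := |r|) (by simpa using hr1)
    refine this.congr fun m => ?_
    rw [mul_comm, Nat.choose_symm_add]
  unfold TT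
  simp only [← integral_const_mul]
  refine hasSum_integral_of_dominated_convergence
    (fun m p => |r| ^ m * ((m + d).choose m : ℝ) * ‖f p‖) (fun m => ?_) (fun m => ?_) ?_ ?_ ?_
  · exact ((TT_int f (ph_cont1 d m lam) (ph_bound d m lam) lam).const_mul _).aestronglyMeasurable
  · refine Eventually.of_forall fun p => ?_
    rw [norm_mul, Complex.norm_real, norm_pow, Real.norm_eq_abs, mul_assoc (|r| ^ m)]
    exact mul_le_mul_of_nonneg_left (TT_norm_le f (ph_bound d m lam) lam p) (pow_nonneg (abs_nonneg _) _)
  · exact Eventually.of_forall fun p => hsumm.mul_right _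
  · simp only [tsum_mul_right]
    exact f.integrable.norm.const_mul _
  · refine Eventually.of_forall fun p => ?_
    have h := gen_fun d hr1 (2 * |lam| * hnormSq p.1)
    have h2 : HasSum (fun m => r ^ m * ph d m lam p.1)
        (1 / (2 * |lam| / (|lam| + sg)) ^ (d + 1) * Real.exp (-(sg * hnormSq p.1))) := by
      refine hasSum_of_eq (h.mul_right (Real.exp (-(|lam| * hnormSq p.1)))) (fun k => ?_) ?_
      · unfold ph; ring
      · rw [show 1 - r = 2 * |lam| / (|lam| + sg) by rw [hr]; ring, mul_assoc, ← Real.exp_add]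
        congr 2
        rw [hr]
        field_simp
        ring
    have h3 := (Complex.hasSum_ofReal.mpr h2).mul_left (Complex.exp (Complex.I * lam * p.2) * f p)
    refine hasSum_of_eqC h3 (fun m => ?_) ?_
    · rw [Complex.ofReal_mul (r ^ m)]; ring
    · rw [Complex.ofReal_mul (1 / (2 * |lam| / (|lam| + sg)) ^ (d + 1))]; ring

end

section
variable {d : ℕ} (f : SchwartzMap ((Fin (d + 1) → ℂ) × ℝ) ℂ)

noncomputable def FF (m : ℕ) (p : (Fin (d + 1) → ℂ) × ℝ) (lam : ℝ) : ℂ :=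
  Complex.exp (-(Complex.I * lam * p.2)) * sphFT (d + 1) f m lam *
    ((ph d m lam p.1 * |lam| ^ (d + 1) : ℝ) : ℂ)

noncomputable def tm (m : ℕ) (p : (Fin (d + 1) → ℂ) × ℝ) : ℂ := ∫ lam : ℝ, FF f m p lam

noncomputable def BB (m : ℕ) : ℝ :=
  (((m + d).choose m : ℕ) : ℝ) * ∫ lam : ℝ, ‖sphFT (d + 1) f m lam‖ * |lam| ^ (d + 1)

lemma FF_bound (m : ℕ) (p : (Fin (d + 1) → ℂ) × ℝ) (lam : ℝ) :
    ‖FF f m p lam‖ ≤ (((m + d).choose m : ℕ) : ℝ) * (‖sphFT (d + 1) f m lam‖ * |lam| ^ (d + 1)) := by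
  unfold FF
  rw [norm_mul, norm_mul, norm_exp_negI, one_mul, Complex.norm_real, norm_mul, Real.norm_eq_abs,
    Real.norm_of_nonneg (pow_nonneg (abs_nonneg lam) _)]
  have := mul_le_mul_of_nonneg_right (ph_bound d m lam p.1)
    (mul_nonneg (norm_nonneg (sphFT (d + 1) f m lam)) (pow_nonneg (abs_nonneg lam) (d + 1)))
  calc _ = |ph d m lam p.1| * (‖sphFT (d + 1) f m lam‖ * |lam| ^ (d + 1)) := by ring
    _ ≤ _ := this

lemma FF_cont (m : ℕ) : Continuous (fun q : ((Fin (d + 1) → ℂ) × ℝ) × ℝ => FF f m q.1 q.2) := by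
  have h1 : Continuous fun q : ((Fin (d + 1) → ℂ) × ℝ) × ℝ => sphFT (d + 1) f m q.2 :=
    Continuous.comp (g := fun lam => sphFT (d + 1) f m lam) (sph_cont f m) continuous_snd
  have h2 : Continuous fun q : ((Fin (d + 1) → ℂ) × ℝ) × ℝ => ph d m q.2 q.1.1 :=
    Continuous.comp (g := Function.uncurry (ph d m)) (f := fun q : ((Fin (d + 1) → ℂ) × ℝ) × ℝ => (q.2, q.1.1))
      (ph_cont d m) (by fun_prop)
  unfold FF
  have h3 : Continuous fun q : ((Fin (d + 1) → ℂ) × ℝ) × ℝ => Complex.exp (-(Complex.I * q.2 * q.1.2)) := by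
    fun_prop
  exact (h3.mul h1).mul (Complex.continuous_ofReal.comp (h2.mul (continuous_snd.abs.pow _)))

lemma FF_cont1 (m : ℕ) (p : (Fin (d + 1) → ℂ) × ℝ) : Continuous (FF f m p) :=
  Continuous.comp (g := fun q : ((Fin (d + 1) → ℂ) × ℝ) × ℝ => FF f m q.1 q.2) (f := fun lam => (p, lam))
    (FF_cont f m) (by fun_prop)

lemma tm_bound (m : ℕ) (p : (Fin (d + 1) → ℂ) × ℝ) : ‖tm f m p‖ ≤ BB f m := by
  unfold tm BB
  rw [← integral_const_mul]
  exact norm_integral_le_of_norm_le ((sph_int f m).const_mul _) (Eventually.of_forall (FF_bound f m p))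

lemma BB_nonneg (m : ℕ) : 0 ≤ BB f m := (norm_nonneg _).trans (tm_bound f m (0, 0))

lemma tm_cont (m : ℕ) : Continuous (tm f m) := by
  unfold tm
  refine continuous_of_dominated (fun p => (FF_cont1 f m p).aestronglyMeasurable)
    (fun p => Eventually.of_forall (FF_bound f m p)) ((sph_int f m).const_mul _)
    (Eventually.of_forall fun lam => ?_)
  exact Continuous.comp (g := fun q : ((Fin (d + 1) → ℂ) × ℝ) × ℝ => FF f m q.1 q.2) (f := fun p => (p, lam))
    (FF_cont f m) (by fun_prop)

lemma tm_rad (m : ℕ) (z z' : Fin (d + 1) → ℂ) (s : ℝ) (h : hnormSq z = hnormSq z') :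
    tm f m (z, s) = tm f m (z', s) := by
  unfold tm FF ph; simp only [h]

noncomputable def GG (sg s : ℝ) (m : ℕ) (lam : ℝ) : ℂ :=
  Complex.exp (-(Complex.I * lam * s)) * TT f (ph d m lam) lam *
    (((1 - 2 * |lam| / (|lam| + sg)) ^ m * (|lam| ^ (d + 1) * (Real.pi ^ (d + 1) / (|lam| + sg) ^ (d + 1))) : ℝ) : ℂ)

lemma TT_sph (m : ℕ) (lam : ℝ) : TT f (ph d m lam) lam = (((m + d).choose m : ℕ) : ℂ) * sphFT (d + 1) f m lam := by
  have : (((m + d).choose m : ℕ) : ℂ) ≠ 0 := by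
    exact_mod_cast (Nat.choose_pos (by omega)).ne'
  rw [sph_eq, mul_inv_cancel_left₀ this]

lemma ph_gauss (m : ℕ) (lam : ℝ) {sg : ℝ} (hs : 0 < sg) :
    ∫ z, ph d m lam z * Real.exp (-(sg * hnormSq z)) =
      Real.pi ^ (d + 1) / (|lam| + sg) ^ (d + 1) * (m + d).choose m * (1 - 2 * |lam| / (|lam| + sg)) ^ m := by
  rw [← lag_laplace d m |lam| (p := |lam| + sg) (by positivity)]
  congr 1; funext z
  unfold ph
  rw [mul_assoc, ← Real.exp_add]
  congr 2; ring

lemma tm_gauss (m : ℕ) (s : ℝ) {sg : ℝ} (hs : 0 < sg) :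
    ∫ z, tm f m (z, s) * (Real.exp (-(sg * hnormSq z)) : ℂ) = ∫ lam, GG f sg s m lam := by
  unfold tm
  simp only [← integral_mul_const]
  rw [integral_integral_swap]
  · congr 1; funext lam
    have h1 : ∀ z, FF f m (z, s) lam * ((Real.exp (-(sg * hnormSq z)) : ℝ) : ℂ) =
        (Complex.exp (-(Complex.I * lam * s)) * sphFT (d + 1) f m lam * ((|lam| ^ (d + 1) : ℝ) : ℂ)) *
          ((ph d m lam z * Real.exp (-(sg * hnormSq z)) : ℝ) : ℂ) := by
      intro z; unfold FF; push_cast; ring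
    calc _ = ∫ z, (Complex.exp (-(Complex.I * lam * s)) * sphFT (d + 1) f m lam * ((|lam| ^ (d + 1) : ℝ) : ℂ)) *
          ((ph d m lam z * Real.exp (-(sg * hnormSq z)) : ℝ) : ℂ) := by
            congr 1; funext z; exact h1 z
      _ = _ := by
        rw [integral_const_mul, integral_complex_ofReal, ph_gauss m lam hs]
        unfold GG
        rw [TT_sph]
        push_cast; ring
  · have hb : Integrable (fun q : (Fin (d + 1) → ℂ) × ℝ => Real.exp (-(sg * hnormSq q.1)) *
        ((((m + d).choose m : ℕ) : ℝ) * (‖sphFT (d + 1) f m q.2‖ * |q.2| ^ (d + 1)))) :=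
      (gauss_int0 (d + 1) hs).mul_prod ((sph_int f m).const_mul _)
    refine hb.mono' ?_ (Eventually.of_forall fun q => ?_)
    · have h1 : Continuous fun q : (Fin (d + 1) → ℂ) × ℝ => FF f m (q.1, s) q.2 :=
        Continuous.comp (g := fun q : ((Fin (d + 1) → ℂ) × ℝ) × ℝ => FF f m q.1 q.2)
          (f := fun q : (Fin (d + 1) → ℂ) × ℝ => ((q.1, s), q.2)) (FF_cont f m) (by fun_prop)
      have h2 : Continuous fun q : (Fin (d + 1) → ℂ) × ℝ => Real.exp (-(sg * hnormSq q.1)) :=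
        Real.continuous_exp.comp (continuous_const.mul (hnormSq_cont.comp continuous_fst)).neg
      exact (h1.mul (Complex.continuous_ofReal.comp h2)).aestronglyMeasurable
    · change ‖FF f m (q.1, s) q.2 * ((Real.exp (-(sg * hnormSq q.1)) : ℝ) : ℂ)‖ ≤ _
      rw [norm_mul, Complex.norm_real, Real.norm_of_nonneg (Real.exp_pos _).le, mul_comm]
      exact mul_le_mul_of_nonneg_left (FF_bound f m _ _) (Real.exp_pos _).le

lemma rr_le {lam sg : ℝ} (hs : 0 < sg) : |1 - 2 * |lam| / (|lam| + sg)| ≤ 1 := by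
  by_cases h : lam = 0
  · simp [h]
  · exact (rr_lt h hs).le

lemma GG_bound (m : ℕ) (s : ℝ) {sg : ℝ} (hs : 0 < sg) (lam : ℝ) :
    ‖GG f sg s m lam‖ ≤ (Real.pi ^ (d + 1) / sg ^ (d + 1)) *
      ((((m + d).choose m : ℕ) : ℝ) * (‖sphFT (d + 1) f m lam‖ * |lam| ^ (d + 1))) := by
  unfold GG
  rw [TT_sph, norm_mul, norm_mul, norm_exp_negI, one_mul, Complex.norm_real, norm_mul, norm_mul, norm_mul,
    norm_pow, Real.norm_eq_abs, Real.norm_of_nonneg (pow_nonneg (abs_nonneg lam) _), Complex.norm_natCast]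
  have hp : 0 < |lam| + sg := by positivity
  have h1 : |1 - 2 * |lam| / (|lam| + sg)| ^ m ≤ 1 := pow_le_one₀ (abs_nonneg _) (rr_le hs)
  have h2 : ‖Real.pi ^ (d + 1) / (|lam| + sg) ^ (d + 1)‖ ≤ Real.pi ^ (d + 1) / sg ^ (d + 1) := by
    rw [Real.norm_of_nonneg (by positivity)]
    have : sg ≤ |lam| + sg := by linarith [abs_nonneg lam]
    gcongr
  have h3 : |1 - 2 * |lam| / (|lam| + sg)| ^ m * ‖Real.pi ^ (d + 1) / (|lam| + sg) ^ (d + 1)‖ ≤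
      1 * (Real.pi ^ (d + 1) / sg ^ (d + 1)) := mul_le_mul h1 h2 (norm_nonneg _) zero_le_one
  have h4 : (0:ℝ) ≤ (((m + d).choose m : ℕ) : ℝ) * (‖sphFT (d + 1) f m lam‖ * |lam| ^ (d + 1)) := by positivity
  calc _ = (|1 - 2 * |lam| / (|lam| + sg)| ^ m * ‖Real.pi ^ (d + 1) / (|lam| + sg) ^ (d + 1)‖) *
        ((((m + d).choose m : ℕ) : ℝ) * (‖sphFT (d + 1) f m lam‖ * |lam| ^ (d + 1))) := by ring
    _ ≤ _ := by
      have := mul_le_mul_of_nonneg_right h3 h4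
      rwa [one_mul] at this

lemma GG_cont (m : ℕ) (s : ℝ) {sg : ℝ} (hs : 0 < sg) : Continuous (GG f sg s m) := by
  have h1 : Continuous fun lam => TT f (ph d m lam) lam := TT_cont f (ph_cont d m) (ph_bound d m)
  have hp : ∀ lam : ℝ, |lam| + sg ≠ 0 := fun lam => by positivity
  have hp2 : ∀ lam : ℝ, (|lam| + sg) ^ (d + 1) ≠ 0 := fun lam => pow_ne_zero _ (hp lam)
  have h0 : Continuous fun lam : ℝ => |lam| + sg := by fun_prop
  have h2 : Continuous fun lam : ℝ => (1 - 2 * |lam| / (|lam| + sg)) ^ m *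
      (|lam| ^ (d + 1) * (Real.pi ^ (d + 1) / (|lam| + sg) ^ (d + 1))) :=
    ((continuous_const.sub ((continuous_const.mul continuous_abs).div h0 hp)).pow _).mul
      ((continuous_abs.pow _).mul (continuous_const.div (h0.pow _) hp2))
  have h3 : Continuous fun lam : ℝ => Complex.exp (-(Complex.I * lam * s)) := by fun_prop
  exact (h3.mul h1).mul (Complex.continuous_ofReal.comp h2)

lemma GG_sum (s : ℝ) {sg : ℝ} (hs : 0 < sg) {lam : ℝ} (hl : lam ≠ 0) :
    HasSum (fun m => GG f sg s m lam) ((((Real.pi / 2) ^ (d + 1) : ℝ) : ℂ) *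
      (Complex.exp (-(Complex.I * lam * s)) * TT f (fun z => Real.exp (-(sg * hnormSq z))) lam)) := by
  have h := (gen_TT f hl hs).mul_left (Complex.exp (-(Complex.I * lam * s)) *
    ((|lam| ^ (d + 1) * (Real.pi ^ (d + 1) / (|lam| + sg) ^ (d + 1)) : ℝ) : ℂ))
  refine hasSum_of_eqC h (fun m => ?_) ?_
  · unfold GG; rw [Complex.ofReal_mul]; ring
  · have hl0 := abs_pos.mpr hl
    have : (Real.pi / 2) ^ (d + 1) = |lam| ^ (d + 1) * (Real.pi ^ (d + 1) / (|lam| + sg) ^ (d + 1)) *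
        (1 / (2 * |lam| / (|lam| + sg)) ^ (d + 1)) := by
      rw [div_pow, div_pow, mul_pow]
      field_simp
    rw [this, Complex.ofReal_mul]; ring

end

section
variable {d : ℕ} (f : SchwartzMap ((Fin (d + 1) → ℂ) × ℝ) ℂ)

lemma egauss_cont (d : ℕ) (sg : ℝ) : Continuous fun z : Fin (d + 1) → ℂ => Real.exp (-(sg * hnormSq z)) :=
  Real.continuous_exp.comp (continuous_const.mul hnormSq_cont).neg

lemma egauss_le (d : ℕ) {sg : ℝ} (hs : 0 < sg) (z : Fin (d + 1) → ℂ) : |Real.exp (-(sg * hnormSq z))| ≤ 1 := by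
  rw [abs_of_pos (Real.exp_pos _), Real.exp_le_one_iff]
  have := mul_nonneg hs.le (hnormSq_nonneg z)
  linarith

lemma bdd_gauss_int {h : (Fin (d + 1) → ℂ) → ℂ} (hc : Continuous h) {C : ℝ} (hb : ∀ z, ‖h z‖ ≤ C) {sg : ℝ} (hs : 0 < sg) :
    Integrable fun z => h z * ((Real.exp (-(sg * hnormSq z)) : ℝ) : ℂ) := by
  refine ((gauss_int0 (d + 1) hs).const_mul C).mono' ?_ (Eventually.of_forall fun z => ?_)
  · exact (hc.mul (Complex.continuous_ofReal.comp (egauss_cont d sg))).aestronglyMeasurable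
  · rw [norm_mul, Complex.norm_real, Real.norm_of_nonneg (Real.exp_pos _).le]
    exact mul_le_mul_of_nonneg_right (hb z) (Real.exp_pos _).le

lemma main_gauss (hsum : Summable (BB f)) (s : ℝ) {sg : ℝ} (hs : 0 < sg) :
    ∫ z, (∑' m, tm f m (z, s)) * ((Real.exp (-(sg * hnormSq z)) : ℝ) : ℂ) =
      (((Real.pi / 2) ^ (d + 1) : ℝ) : ℂ) * (2 * Real.pi *
        ∫ z, f (z, s) * ((Real.exp (-(sg * hnormSq z)) : ℝ) : ℂ)) := by
  have tc : ∀ m, Continuous fun z => tm f m (z, s) := fun m =>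
    Continuous.comp (g := tm f m) (f := fun z => (z, s)) (tm_cont f m) (by fun_prop)
  have i1 : ∀ m, Integrable fun z => tm f m (z, s) * ((Real.exp (-(sg * hnormSq z)) : ℝ) : ℂ) := fun m =>
    bdd_gauss_int (tc m) (fun z => tm_bound f m (z, s)) hs
  have h1 := hasSum_integral_of_summable_integral_norm i1 (by
    refine Summable.of_nonneg_of_le (fun m => integral_nonneg fun z => norm_nonneg _) (fun m => ?_)
      (hsum.mul_right (∫ z : Fin (d + 1) → ℂ, Real.exp (-(sg * hnormSq z))))
    rw [← integral_const_mul]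
    refine integral_mono (i1 m).norm ((gauss_int0 (d + 1) hs).const_mul _) fun z => ?_
    change ‖tm f m (z, s) * ((Real.exp (-(sg * hnormSq z)) : ℝ) : ℂ)‖ ≤ _
    rw [norm_mul, Complex.norm_real, Real.norm_of_nonneg (Real.exp_pos _).le]
    exact mul_le_mul_of_nonneg_right (tm_bound f m _) (Real.exp_pos _).le)
  have b2 : ∀ m, Integrable fun lam : ℝ => (Real.pi ^ (d + 1) / sg ^ (d + 1)) *
      ((((m + d).choose m : ℕ) : ℝ) * (‖sphFT (d + 1) f m lam‖ * |lam| ^ (d + 1))) := fun m =>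
    ((sph_int f m).const_mul _).const_mul _
  have i2 : ∀ m, Integrable (GG f sg s m) := fun m =>
    (b2 m).mono' (GG_cont f m s hs).aestronglyMeasurable (Eventually.of_forall (GG_bound f m s hs))
  have h2 := hasSum_integral_of_summable_integral_norm i2 (by
    refine Summable.of_nonneg_of_le (fun m => integral_nonneg fun z => norm_nonneg _) (fun m => ?_)
      (hsum.mul_left (Real.pi ^ (d + 1) / sg ^ (d + 1)))
    unfold BB
    rw [← integral_const_mul, ← integral_const_mul]
    exact integral_mono (i2 m).norm (b2 m) (GG_bound f m s hs))
  have h3 : (fun m => ∫ z, tm f m (z, s) * ((Real.exp (-(sg * hnormSq z)) : ℝ) : ℂ)) =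
      fun m => ∫ lam, GG f sg s m lam := funext fun m => tm_gauss f m s hs
  rw [h3] at h1
  have h4 := h1.unique h2
  simp only [tsum_mul_right] at h4
  rw [h4, ← TT_inv f (egauss_cont d sg) (egauss_le d hs) (gauss_int0 (d + 1) hs) s, ← integral_const_mul]
  refine integral_congr_ae ?_
  have : ∀ᵐ lam : ℝ, lam ≠ 0 := by simp [ae_iff]
  filter_upwards [this] with lam hl
  exact (GG_sum f s hs hl).tsum_eq

lemma main_eq (hrad : ∀ (z z' : Fin (d + 1) → ℂ) (s : ℝ), hnormSq z = hnormSq z' → f (z, s) = f (z', s))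
    (hsum : Summable (BB f)) (z : Fin (d + 1) → ℂ) (s : ℝ) :
    (((2 : ℝ) ^ d / Real.pi ^ (d + 2) : ℝ) : ℂ) * ∑' m, tm f m (z, s) = f (z, s) := by
  set C : ℂ := (((2 : ℝ) ^ d / Real.pi ^ (d + 2) : ℝ) : ℂ) with hC
  have gb : ∀ p, ‖∑' m, tm f m p‖ ≤ ∑' m, BB f m := fun p =>
    tsum_of_norm_bounded hsum.hasSum fun m => tm_bound f m p
  have gc : Continuous fun z => ∑' m, tm f m (z, s) := by
    refine continuous_tsum (fun m => ?_) hsum (fun m z => tm_bound f m _)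
    exact Continuous.comp (g := tm f m) (f := fun z => (z, s)) (tm_cont f m) (by fun_prop)
  have fc : Continuous fun z => f (z, s) :=
    Continuous.comp (g := f) (f := fun z => (z, s)) f.continuous (by fun_prop)
  have fb : ∀ z, ‖f (z, s)‖ ≤ SchwartzMap.seminorm ℝ 0 0 f := fun z => SchwartzMap.norm_le_seminorm ℝ f _
  have key := uniq_cplx d (fun z => C * (∑' m, tm f m (z, s)) - f (z, s)) ((continuous_const.mul gc).sub fc)
    (‖C‖ * (∑' m, BB f m) + SchwartzMap.seminorm ℝ 0 0 f) (fun z => ?_) (fun z z' h => ?_) (fun sg hs => ?_) z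
  · exact sub_eq_zero.mp key
  · refine (norm_sub_le _ _).trans (add_le_add ?_ (fb z))
    rw [norm_mul]
    exact mul_le_mul_of_nonneg_left (gb _) (norm_nonneg _)
  · simp only [hrad z z' s h, fun m => tm_rad f m z z' s h]
  · have i1 := bdd_gauss_int gc (fun z => gb (z, s)) hs
    have i2 := bdd_gauss_int fc fb hs
    calc _ = ∫ z, (C * ((∑' m, tm f m (z, s)) * ((Real.exp (-(sg * hnormSq z)) : ℝ) : ℂ)) -
            f (z, s) * ((Real.exp (-(sg * hnormSq z)) : ℝ) : ℂ)) := by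
          congr 1; funext z; ring
      _ = 0 := by
        rw [integral_sub (i1.const_mul C) i2, integral_const_mul, main_gauss f hsum s hs]
        generalize (∫ z, f (z, s) * ((Real.exp (-(sg * hnormSq z)) : ℝ) : ℂ)) = J
        have h1 : C * ((((Real.pi / 2) ^ (d + 1) : ℝ) : ℂ) * (2 * Real.pi)) = 1 := by
          rw [hC]
          have : (2 : ℝ) ^ d / Real.pi ^ (d + 2) * ((Real.pi / 2) ^ (d + 1) * (2 * Real.pi)) = 1 := by
            rw [div_pow]
            have := Real.pi_ne_zero
            field_simp
            ring
          exact_mod_cast this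
        linear_combination J * h1

end
/-- Fourier inversion formula on the Heisenberg group for radial Schwartz functions,
with uniform convergence of the series. -/
theorem statement0 (n : ℕ) (hn : 1 ≤ n) (f : SchwartzMap ((Fin n → ℂ) × ℝ) ℂ)
    (hrad : ∀ (z z' : Fin n → ℂ) (s : ℝ), hnormSq z = hnormSq z' → f (z, s) = f (z', s))
    (hsum : Summable fun m : ℕ =>
      (Nat.choose (m + n - 1) m : ℝ) * ∫ lam : ℝ, ‖sphFT n (⇑f) m lam‖ * |lam| ^ n) :
    TendstoUniformly
      (fun M : ℕ => fun p : (Fin n → ℂ) × ℝ =>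
        (((2 : ℝ) ^ (n - 1) / Real.pi ^ (n + 1) : ℝ) : ℂ) *
          ∑ m ∈ Finset.range M, ∫ lam : ℝ,
            Complex.exp (-(Complex.I * lam * p.2)) * sphFT n (⇑f) m lam *
              ((laguerreL (n - 1) m (2 * |lam| * hnormSq p.1) *
                Real.exp (-(|lam| * hnormSq p.1)) * |lam| ^ n : ℝ) : ℂ))
      (fun p => f p) atTop := by
  obtain ⟨d, rfl⟩ : ∃ d, n = d + 1 := ⟨n - 1, by omega⟩
  have hs : Summable (BB f) := hsum
  have hb : ∀ m p, ‖(((2 : ℝ) ^ d / Real.pi ^ (d + 2) : ℝ) : ℂ) * tm f m p‖ ≤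
      ‖(((2 : ℝ) ^ d / Real.pi ^ (d + 2) : ℝ) : ℂ)‖ * BB f m := fun m p => by
    rw [norm_mul]
    exact mul_le_mul_of_nonneg_left (tm_bound f m p) (norm_nonneg _)
  have h := tendstoUniformly_tsum_nat (hs.mul_left ‖(((2 : ℝ) ^ d / Real.pi ^ (d + 2) : ℝ) : ℂ)‖) hb
  have h1 : (fun p : (Fin (d + 1) → ℂ) × ℝ => ∑' m, (((2 : ℝ) ^ d / Real.pi ^ (d + 2) : ℝ) : ℂ) * tm f m p) =
      fun p => f p := by
    funext p
    rw [tsum_mul_left]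
    exact main_eq f hrad hs p.1 p.2
  rw [h1] at h
  simp only [← Finset.mul_sum] at h
  exact h
end

section
/- There is an absolute constant C > 0 with the following property: for all real numbers a < b, every δ > 0, every real-valued smooth function g on [a,b] with |g''(x)| ≥ δ for all x ∈ [a,b], every smooth function ψ on [a,b], and every t > 0, one has |∫_a^b e^{i t g(x)} ψ(x) dx| ≤ C (tδ)^{-1/2} ( sup_{x∈[a,b]} |ψ(x)| + ∫_a^b |ψ'(x)| dx ). -/
open MeasureTheory Set intervalIntegral

theorem vdc_core (a b : ℝ) (hab : a < b) (h u v : ℝ → ℝ) (ψ φ : ℝ → ℂ)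
    (hhc : ContinuousOn h (Icc a b)) (huc : ContinuousOn u (Icc a b))
    (hvc : ContinuousOn v (Icc a b)) (hψc : ContinuousOn ψ (Icc a b))
    (hφc : ContinuousOn φ (Icc a b))
    (hh : ∀ x ∈ Ioo a b, HasDerivAt h (u x) x)
    (hu : ∀ x ∈ Ioo a b, HasDerivAt u (v x) x)
    (hψ : ∀ x ∈ Ioo a b, HasDerivAt ψ (φ x) x)
    (s : ℝ) (hs : 0 < s) (ε : ℝ) (hε : ε = 1 ∨ ε = -1)
    (hv : ∀ x ∈ Icc a b, s ^ 2 ≤ ε * v x)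
    (M : ℝ) (hM : ∀ x ∈ Icc a b, ‖ψ x‖ ≤ M) :
    ‖∫ x in a..b, Complex.exp (Complex.I * h x) * ψ x‖ ≤
      9 * s⁻¹ * (M + ∫ x in a..b, ‖φ x‖) := by
  have hle := hab.le
  have hM0 : 0 ≤ M := (norm_nonneg _).trans (hM a (left_mem_Icc.2 hle))
  have hD : ∀ x, 0 < u x ^ 2 + s ^ 2 := fun x => by positivity
  have hDne : ∀ x, u x ^ 2 + s ^ 2 ≠ 0 := fun x => (hD x).ne'
  let q : ℝ → ℝ := fun x => u x / (u x ^ 2 + s ^ 2)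
  let q' : ℝ → ℝ := fun x => v x * (s ^ 2 - u x ^ 2) / (u x ^ 2 + s ^ 2) ^ 2
  let e : ℝ → ℂ := fun x => Complex.exp (Complex.I * h x)
  let G : ℝ → ℂ := fun x => e x * q x * ψ x
  let G' : ℝ → ℂ := fun x =>
    (e x * (Complex.I * u x) * q x + e x * q' x) * ψ x + e x * q x * φ x
  let A : ℝ → ℝ := fun x => ε * (2 * s⁻¹) * Real.arctan (u x * s⁻¹)
  let A' : ℝ → ℝ := fun x => 2 * (ε * v x) / (u x ^ 2 + s ^ 2)
  have he1 : ∀ x, ‖e x‖ = 1 := fun x => by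
    simp only [e]; rw [mul_comm]; exact Complex.norm_exp_ofReal_mul_I _
  have hqb : ∀ x, |q x| ≤ s⁻¹ / 2 := fun x => by
    simp only [q]
    rw [abs_div, abs_of_pos (hD x), div_le_iff₀ (hD x)]
    have h1 : s⁻¹ / 2 * (u x ^ 2 + s ^ 2) - |u x| = s⁻¹ / 2 * (|u x| - s) ^ 2 := by
      rw [← sq_abs (u x)]; field_simp; ring
    have : 0 ≤ s⁻¹ / 2 * (|u x| - s) ^ 2 := by positivity
    linarith
  have hqc : ContinuousOn q (Icc a b) := huc.div (by fun_prop) fun x _ => hDne x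
  have hq'c : ContinuousOn q' (Icc a b) :=
    ContinuousOn.div (by fun_prop) (by fun_prop) fun x _ => pow_ne_zero _ (hDne x)
  have hA'c : ContinuousOn A' (Icc a b) :=
    ContinuousOn.div (by fun_prop) (by fun_prop) fun x _ => hDne x
  have hec : ContinuousOn e (Icc a b) := by
    simp only [e]; fun_prop
  have hGc : ContinuousOn G (Icc a b) := by
    simp only [G]; fun_prop
  have hG'c : ContinuousOn G' (Icc a b) := by
    simp only [G']; fun_prop
  have hAc : ContinuousOn A (Icc a b) := by
    simp only [A]
    exact continuousOn_const.mul (Real.continuous_arctan.comp_continuousOn (by fun_prop))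
  have hG : ∀ x ∈ Ioo a b, HasDerivAt G (G' x) x := fun x hx => by
    have h1 : HasDerivAt e (e x * (Complex.I * u x)) x :=
      (((hh x hx).ofReal_comp).const_mul Complex.I).cexp
    have h2 : HasDerivAt q (q' x) x := by
      have := (hu x hx).div (((hu x hx).pow 2).add_const (s ^ 2)) (hDne x)
      refine this.congr_deriv ?_
      simp only [q', Pi.pow_apply]
      congr 1
      push_cast
      ring
    exact (h1.mul h2.ofReal_comp).mul (hψ x hx)
  have hA : ∀ x ∈ Ioo a b, HasDerivAt A (A' x) x := fun x hx => by
    have := (((hu x hx).mul_const s⁻¹).arctan).const_mul (ε * (2 * s⁻¹))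
    refine this.congr_deriv ?_
    change _ = 2 * (ε * v x) / (u x ^ 2 + s ^ 2)
    have := hDne x
    have h3 : 1 + (u x * s⁻¹) ^ 2 = (u x ^ 2 + s ^ 2) / s ^ 2 := by field_simp; ring
    rw [h3]
    field_simp
  have ii : ∀ {E : Type} [NormedAddCommGroup E] {f : ℝ → E}, ContinuousOn f (Icc a b) →
      IntervalIntegrable f volume a b := fun hf => hf.intervalIntegrable_of_Icc hle
  have iG : ∫ x in a..b, G' x = G b - G a :=
    integral_eq_sub_of_hasDerivAt_of_le hle hGc hG (ii hG'c)
  have iA : ∫ x in a..b, A' x = A b - A a :=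
    integral_eq_sub_of_hasDerivAt_of_le hle hAc hA (ii hA'c)
  have hpt : ∀ x ∈ Icc a b,
      ‖e x * ψ x + Complex.I * G' x‖ ≤ s⁻¹ / 2 * ‖φ x‖ + M * A' x := fun x hx => by
    have hc : ((u x : ℂ) ^ 2 + (s : ℂ) ^ 2) ≠ 0 := by exact_mod_cast hDne x
    have key : e x * ψ x + Complex.I * G' x =
        e x * ((s ^ 2 / (u x ^ 2 + s ^ 2) : ℝ) + Complex.I * q' x) * ψ x
          + Complex.I * (e x * q x * φ x) := by
      have : (1 : ℂ) - u x * q x = ((s ^ 2 / (u x ^ 2 + s ^ 2) : ℝ) : ℂ) := by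
        simp only [q]; push_cast; field_simp; ring
      rw [← this]
      simp only [G']
      linear_combination (e x * u x * q x * ψ x) * Complex.I_sq
    have hvx := hv x hx
    have hav : |v x| = ε * v x := by
      have h0 : 0 ≤ ε * v x := (sq_nonneg s).trans hvx
      rcases hε with rfl | rfl
      · rw [abs_of_nonneg] <;> linarith
      · rw [abs_of_nonpos] <;> linarith
    have hq'b : |q' x| ≤ ε * v x / (u x ^ 2 + s ^ 2) := by
      simp only [q']
      rw [abs_div, abs_mul, hav, abs_of_pos (pow_pos (hD x) 2),
        div_le_div_iff₀ (pow_pos (hD x) 2) (hD x), pow_two (u x ^ 2 + s ^ 2), ← mul_assoc]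
      have h0 : 0 ≤ ε * v x := (sq_nonneg s).trans hvx
      have : |s ^ 2 - u x ^ 2| ≤ u x ^ 2 + s ^ 2 := by
        rw [abs_le]; constructor <;> nlinarith [sq_nonneg (u x), sq_nonneg s]
      have := hD x
      gcongr
    have hsb : s ^ 2 / (u x ^ 2 + s ^ 2) ≤ ε * v x / (u x ^ 2 + s ^ 2) := by
      have := hD x
      gcongr
    have hR : ‖((s ^ 2 / (u x ^ 2 + s ^ 2) : ℝ) : ℂ) + Complex.I * q' x‖ ≤ A' x := by
      refine (norm_add_le _ _).trans ?_
      rw [norm_mul, Complex.norm_I, one_mul, Complex.norm_real, Complex.norm_real,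
        Real.norm_eq_abs, Real.norm_eq_abs, abs_of_nonneg (div_nonneg (sq_nonneg s) (hD x).le)]
      have : A' x = ε * v x / (u x ^ 2 + s ^ 2) + ε * v x / (u x ^ 2 + s ^ 2) := by
        simp only [A']; ring
      linarith
    rw [key]
    refine (norm_add_le _ _).trans ?_
    simp only [norm_mul, he1, Complex.norm_I, one_mul, Complex.norm_real, Real.norm_eq_abs]
    have h1 := mul_le_mul_of_nonneg_right (hqb x) (norm_nonneg (φ x))
    have h2 := mul_le_mul hR (hM x hx) (norm_nonneg _) ((norm_nonneg _).trans hR)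
    linarith
  have hb := intervalIntegral.norm_integral_le_of_norm_le (μ := volume) hle
    (Filter.Eventually.of_forall fun x hx => hpt x (Ioc_subset_Icc_self hx))
    (((ii hφc.norm).const_mul (s⁻¹ / 2)).add ((ii hA'c).const_mul M))
  have hec' : ContinuousOn (fun x => e x * ψ x) (Icc a b) := hec.mul hψc
  rw [intervalIntegral.integral_add (ii hec') ((ii hG'c).const_mul _),
    intervalIntegral.integral_add ((ii hφc.norm).const_mul _) ((ii hA'c).const_mul _),
    intervalIntegral.integral_const_mul, intervalIntegral.integral_const_mul,
    intervalIntegral.integral_const_mul, iG, iA] at hb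
  have hGb : ∀ x ∈ Icc a b, ‖G x‖ ≤ s⁻¹ / 2 * M := fun x hx => by
    simp only [G, norm_mul, he1, one_mul, Complex.norm_real, Real.norm_eq_abs]
    exact mul_le_mul (hqb x) (hM x hx) (norm_nonneg _) (by positivity)
  have hAb : A b - A a ≤ 8 * s⁻¹ := by
    have h1 := Real.arctan_lt_pi_div_two (u b * s⁻¹)
    have h2 := Real.arctan_lt_pi_div_two (u a * s⁻¹)
    have h3 := Real.neg_pi_div_two_lt_arctan (u b * s⁻¹)
    have h4 := Real.neg_pi_div_two_lt_arctan (u a * s⁻¹)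
    have h5 := Real.pi_lt_four
    have hs' : 0 < s⁻¹ := by positivity
    have : A b - A a = (2 * s⁻¹) *
      (ε * (Real.arctan (u b * s⁻¹) - Real.arctan (u a * s⁻¹))) := by simp only [A]; ring
    rw [this]
    have : ε * (Real.arctan (u b * s⁻¹) - Real.arctan (u a * s⁻¹)) ≤ 4 := by
      rcases hε with rfl | rfl <;> linarith
    nlinarith
  have hI : 0 ≤ ∫ x in a..b, ‖φ x‖ :=
    intervalIntegral.integral_nonneg hle fun x _ => norm_nonneg _
  have hGG : ‖Complex.I * (G b - G a)‖ ≤ s⁻¹ * M := by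
    rw [norm_mul, Complex.norm_I, one_mul]
    have := norm_sub_le (G b) (G a)
    linarith [hGb a (left_mem_Icc.2 hle), hGb b (right_mem_Icc.2 hle)]
  have htri := norm_sub_le ((∫ x in a..b, e x * ψ x) + Complex.I * (G b - G a))
    (Complex.I * (G b - G a))
  rw [add_sub_cancel_right] at htri
  have hMA := mul_le_mul_of_nonneg_left hAb hM0
  have hs' : 0 ≤ s⁻¹ * ∫ x in a..b, ‖φ x‖ := by positivity
  change ‖∫ x in a..b, e x * ψ x‖ ≤ _
  linarith

/-- Van der Corput lemma (second-derivative test) with amplitude: the constant `C`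
is absolute, independent of `a`, `b`, `δ`, `g`, `ψ` and `t`. -/
theorem statement2 :
    ∃ C : ℝ, 0 < C ∧
      ∀ a b : ℝ, a < b → ∀ δ : ℝ, 0 < δ →
        ∀ g : ℝ → ℝ, ContDiffOn ℝ (⊤ : ℕ∞) g (Icc a b) →
          (∀ x ∈ Icc a b, δ ≤ |iteratedDerivWithin 2 g (Icc a b) x|) →
        ∀ ψ : ℝ → ℂ, ContDiffOn ℝ (⊤ : ℕ∞) ψ (Icc a b) →
        ∀ t : ℝ, 0 < t →
          ‖∫ x in a..b, Complex.exp (Complex.I * t * g x) * ψ x‖ ≤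
            C * (t * δ) ^ (-(1 / 2) : ℝ) *
              ((⨆ x ∈ Icc a b, ‖ψ x‖) + ∫ x in a..b, ‖derivWithin ψ (Icc a b) x‖) := by
  refine ⟨9, by norm_num, ?_⟩
  intro a b hab δ hδ g hg hg2 ψ hψ t ht
  have hU := uniqueDiffOn_Icc hab
  have hg1 : ContDiffOn ℝ 1 (derivWithin g (Icc a b)) (Icc a b) :=
    hg.derivWithin hU (by norm_cast)
  have h2eq : ∀ x, iteratedDerivWithin 2 g (Icc a b) x
      = derivWithin (derivWithin g (Icc a b)) (Icc a b) x := fun x => by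
    rw [iteratedDerivWithin_succ, iteratedDerivWithin_one]
  simp only [h2eq] at hg2
  have hg2c : ContinuousOn (derivWithin (derivWithin g (Icc a b)) (Icc a b)) (Icc a b) :=
    hg1.continuousOn_derivWithin hU le_rfl
  have hder : ∀ {E : Type} [NormedAddCommGroup E] [NormedSpace ℝ E] {f : ℝ → E},
      DifferentiableOn ℝ f (Icc a b) →
      ∀ x ∈ Ioo a b, HasDerivAt f (derivWithin f (Icc a b) x) x := fun hf x hx =>
    ((hf x (Ioo_subset_Icc_self hx)).hasDerivWithinAt).hasDerivAt (Icc_mem_nhds hx.1 hx.2)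
  have hsign : ∃ ε : ℝ, (ε = 1 ∨ ε = -1) ∧
      ∀ x ∈ Icc a b, δ ≤ ε * derivWithin (derivWithin g (Icc a b)) (Icc a b) x := by
    set k := derivWithin (derivWithin g (Icc a b)) (Icc a b)
    by_cases hp : ∀ x ∈ Icc a b, 0 < k x
    · refine ⟨1, Or.inl rfl, fun x hx => ?_⟩
      have := hg2 x hx
      rwa [abs_of_pos (hp x hx), ← one_mul (k x)] at this
    · push Not at hp
      obtain ⟨y, hy, hky⟩ := hp
      refine ⟨-1, Or.inr rfl, fun x hx => ?_⟩
      have hx2 := hg2 x hx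
      by_cases hkx : k x ≤ 0
      · rw [abs_of_nonpos hkx] at hx2; linarith
      · push Not at hkx
        obtain ⟨z, hz, hz0⟩ := isPreconnected_Icc.intermediate_value hy hx hg2c ⟨hky, hkx.le⟩
        have := hg2 z hz
        rw [hz0, abs_zero] at this
        linarith
  obtain ⟨ε, hε, hv⟩ := hsign
  have hM : ∀ x ∈ Icc a b, ‖ψ x‖ ≤ ⨆ x ∈ Icc a b, ‖ψ x‖ := fun x hx => by
    obtain ⟨B, hB⟩ := isCompact_Icc.exists_bound_of_continuousOn hψ.continuousOn
    have hbdd : BddAbove (range fun x => ⨆ (_ : x ∈ Icc a b), ‖ψ x‖) := by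
      refine ⟨max B 0, ?_⟩
      rintro _ ⟨y, rfl⟩
      exact Real.iSup_le (fun hy => (hB y hy).trans (le_max_left _ _)) (le_max_right _ _)
    refine le_trans ?_ (le_ciSup hbdd x)
    simp [hx]
  have htd : 0 < t * δ := mul_pos ht hδ
  have key := vdc_core a b hab (fun x => t * g x) (fun x => t * derivWithin g (Icc a b) x)
    (fun x => t * derivWithin (derivWithin g (Icc a b)) (Icc a b) x) ψ (derivWithin ψ (Icc a b))
    (continuousOn_const.mul hg.continuousOn) (continuousOn_const.mul hg1.continuousOn)
    (continuousOn_const.mul hg2c) hψ.continuousOn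
    (hψ.continuousOn_derivWithin hU (by norm_cast))
    (fun x hx => (hder (hg.differentiableOn (by simp)) x hx).const_mul t)
    (fun x hx => (hder (hg1.differentiableOn (by simp)) x hx).const_mul t)
    (hder (hψ.differentiableOn (by simp)))
    (Real.sqrt (t * δ)) (Real.sqrt_pos.2 htd) ε hε
    (fun x hx => by
      rw [Real.sq_sqrt htd.le]
      have := mul_le_mul_of_nonneg_left (hv x hx) ht.le
      linarith) _ hM
  rw [Real.rpow_neg htd.le, ← Real.sqrt_eq_rpow]
  convert key using 6
  push_cast
  ring_nf
end

section
/- For every integer d ≥ 1 and every integer α with 0 ≤ α ≤ d there exists a constant C_{α,d} > 0 such that for all m ∈ ℕ and all τ > 0, |(τ d/dτ)^α ( L_m^{(d-1)}(τ) e^{-τ/2} )| ≤ C_{α,d} (2m+d)^{d - 1/4}, where (τ d/dτ)^α denotes the α-fold application of the operator h ↦ τ·h'. -/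
/-- The operator `h ↦ τ·h'` on functions of `τ`. -/
noncomputable def tauD (h : ℝ → ℝ) : ℝ → ℝ := fun τ => τ * deriv h τ

lemma anti_aux {s : Set ℝ} (hs : Convex ℝ s) {g g' : ℝ → ℝ} (h : ∀ x ∈ s, HasDerivAt g (g' x) x)
    (hn : ∀ x ∈ s, g' x ≤ 0) : AntitoneOn g s := by
  apply antitoneOn_of_deriv_nonpos hs
  · exact fun x hx => (h x hx).continuousAt.continuousWithinAt
  · exact fun x hx => (h x (interior_subset hx)).differentiableAt.differentiableWithinAt
  · intro x hx
    rw [(h x (interior_subset hx)).deriv]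
    exact hn x (interior_subset hx)

/-- Hypotheses on the Laguerre function. -/
structure LagODE (b : ℕ) (N : ℝ) (f f1 f2 : ℝ → ℝ) : Prop where
  h1 : ∀ t, HasDerivAt f (f1 t) t
  h2 : ∀ t, HasDerivAt f1 (f2 t) t
  ode : ∀ t, t * f2 t + (b + 1) * f1 t + (N - t / 4) * f t = 0
  lim : Filter.Tendsto (fun t => t ^ (b + 1) * f t * f1 t) Filter.atTop (nhds 0)

lemma LagODE.H {b : ℕ} {N : ℝ} {f f1 f2 : ℝ → ℝ} (h : LagODE b N f f1 f2) {t : ℝ} (ht : 0 ≤ t) :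
    t * f1 t ^ 2 + (N - t / 4) * f t ^ 2 ≤ N * f 0 ^ 2 := by
  have : AntitoneOn (fun t => t * f1 t ^ 2 + (N - t / 4) * f t ^ 2) (Set.Ici 0) := by
    apply anti_aux (convex_Ici 0) (g' := fun t => -(2 * b + 1) * f1 t ^ 2 - f t ^ 2 / 4)
    · intro x _
      have e := ((hasDerivAt_id x).mul ((h.h2 x).pow 2)).add
        ((((hasDerivAt_id x).div_const 4).const_sub N).mul ((h.h1 x).pow 2))
      refine e.congr_deriv ?_
      simp
      linear_combination 2 * f1 x * h.ode x
    · intro x _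
      have : 0 ≤ (b : ℝ) := by positivity
      nlinarith [sq_nonneg (f1 x), sq_nonneg (f x), mul_nonneg this (sq_nonneg (f1 x))]
  have := this (Set.self_mem_Ici) (Set.mem_Ici.2 ht) ht
  simpa using this

lemma LagODE.neg {b : ℕ} {N : ℝ} {f f1 f2 : ℝ → ℝ} (h : LagODE b N f f1 f2) (hN : 0 < N) {t : ℝ}
    (ht : 4 * N ≤ t) : f t * f1 t ≤ 0 := by
  have : AntitoneOn (fun t => - (t ^ (b + 1) * f t * f1 t)) (Set.Ici (4 * N)) := by
    apply anti_aux (convex_Ici _)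
      (g' := fun t => - (t ^ (b + 1) * f1 t ^ 2 + (t / 4 - N) * t ^ b * f t ^ 2))
    · intro x _
      have e := ((((hasDerivAt_id x).pow (b + 1)).mul (h.h1 x)).mul (h.h2 x)).neg
      refine e.congr_deriv ?_
      simp
      linear_combination (- x ^ b * f x) * h.ode x
    · intro x hx
      have hx' : 4 * N ≤ x := hx
      have : 0 ≤ x / 4 - N := by linarith
      have : 0 ≤ x := by linarith
      have : 0 ≤ x ^ (b + 1) * f1 x ^ 2 + (x / 4 - N) * x ^ b * f x ^ 2 := by positivity
      linarith
  have h3 : t ^ (b + 1) * f t * f1 t ≤ 0 := by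
    refine ge_of_tendsto h.lim ?_
    filter_upwards [Filter.eventually_ge_atTop t] with s hs
    have := this (Set.mem_Ici.2 ht) (Set.mem_Ici.2 (ht.trans hs)) hs
    simp only at this
    linarith
  have h4 : 0 < t ^ (b + 1) := by have : 0 < t := by linarith
                                  positivity
  by_contra h5
  push Not at h5
  nlinarith [mul_pos h4 h5]

lemma LagODE.far1 {b : ℕ} {N : ℝ} {f f1 f2 : ℝ → ℝ} (h : LagODE b N f f1 f2) (hN : 0 < N) {t : ℝ}
    (ht : 4 * N ≤ t) : t ^ (2 * b + 2) * f1 t ^ 2 ≤ (4 * N) ^ (2 * b + 2) * f1 (4 * N) ^ 2 := by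
  have : AntitoneOn (fun t => t ^ (2 * b + 2) * f1 t ^ 2) (Set.Ici (4 * N)) := by
    apply anti_aux (convex_Ici _)
      (g' := fun t => 2 * (t / 4 - N) * t ^ (2 * b + 1) * (f t * f1 t))
    · intro x _
      have e := (((hasDerivAt_id x).pow (2 * b + 2)).mul ((h.h2 x).pow 2))
      refine e.congr_deriv ?_
      simp
      linear_combination (2 * x ^ (2 * b + 1) * f1 x) * h.ode x
    · intro x hx
      have hx' : 4 * N ≤ x := hx
      have h1 : 0 ≤ x / 4 - N := by linarith
      have h2 : 0 ≤ x := by linarith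
      exact mul_nonpos_of_nonneg_of_nonpos (by positivity) (h.neg hN hx')
  exact this (Set.self_mem_Ici) (Set.mem_Ici.2 ht) ht

lemma LagODE.far0 {b : ℕ} {N : ℝ} {f f1 f2 : ℝ → ℝ} (h : LagODE b N f f1 f2) (hN : 0 < N) {t : ℝ}
    (ht : 4 * N ≤ t) : f t ^ 2 ≤ f (4 * N) ^ 2 := by
  have : AntitoneOn (fun t => f t ^ 2) (Set.Ici (4 * N)) := by
    apply anti_aux (convex_Ici _) (g' := fun t => 2 * (f t * f1 t))
    · intro x _
      refine ((h.h1 x).pow 2).congr_deriv ?_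
      simp
      ring
    · intro x hx
      have := h.neg hN hx
      linarith
  exact this (Set.self_mem_Ici) (Set.mem_Ici.2 ht) ht

noncomputable def lagW (k N : ℝ) (f f1 : ℝ → ℝ) (t : ℝ) : ℝ :=
  t ^ k * (t * f1 t ^ 2 + k * (f t * f1 t) + (N - t / 4) * f t ^ 2 + k ^ 2 / 2 * (f t ^ 2 / t))

noncomputable def lagW' (b k : ℝ) (f f1 : ℝ → ℝ) (t : ℝ) : ℝ :=
  t ^ k / t ^ 2 * (-(1 / 2) * t ^ 2 * f1 t ^ 2 + k * (2 * k - b - 1) * t * (f t * f1 t)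
    + f t ^ 2 * (-t ^ 2 / 4 + k ^ 2 * (k - 1) / 2))

noncomputable def lagB (b k : ℝ) : ℝ := k ^ 3 / 2 + (k * (2 * k - b - 1)) ^ 2 / 2

lemma LagODE.hasDerivW {b : ℕ} {N : ℝ} {f f1 f2 : ℝ → ℝ} (h : LagODE b N f f1 f2) {k : ℝ}
    (hk : k = b + 1 / 4) {t : ℝ} (ht : 0 < t) :
    HasDerivAt (lagW k N f f1) (lagW' b k f f1 t) t := by
  have e0 := Real.hasDerivAt_rpow_const (x := t) (p := k) (Or.inl ht.ne')
  have e1 := (((hasDerivAt_id t).mul ((h.h2 t).pow 2)).add (((h.h1 t).mul (h.h2 t)).const_mul k)).add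
        ((((hasDerivAt_id t).div_const 4).const_sub N).mul ((h.h1 t).pow 2))
  have e2 := e1.add (((((h.h1 t).pow 2)).div (hasDerivAt_id t) ht.ne').const_mul (k ^ 2 / 2))
  refine (e0.mul e2).congr_deriv ?_
  have o : f2 t = (-(b + 1) * f1 t - (N - t / 4) * f t) / t := by
    rw [eq_div_iff ht.ne']
    linear_combination h.ode t
  rw [Real.rpow_sub_one ht.ne']
  simp [lagW']
  rw [o]
  subst hk
  field_simp
  ring

lemma lagW'_le (b : ℝ) {k : ℝ} (f f1 : ℝ → ℝ) {t : ℝ} (ht : 0 < t) :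
    lagW' b k f f1 t ≤ t ^ k / t ^ 2 * (f t ^ 2 * (lagB b k - t ^ 2 / 4)) := by
  unfold lagW' lagB
  refine mul_le_mul_of_nonneg_left ?_ (by positivity)
  nlinarith [sq_nonneg (t * f1 t - k * (2 * k - b - 1) * f t), sq_nonneg (k * f t)]

lemma lagW_ge {k N : ℝ} (f f1 : ℝ → ℝ) {t : ℝ} (ht : 0 < t) :
    t ^ k * (t * f1 t ^ 2 / 2 + (N - t / 4) * f t ^ 2) ≤ lagW k N f f1 t := by
  unfold lagW
  refine mul_le_mul_of_nonneg_left ?_ (by positivity)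
  have : 0 ≤ (t * f1 t + k * f t) ^ 2 / (2 * t) := by positivity
  have e : (t * f1 t + k * f t) ^ 2 / (2 * t) =
    t * f1 t ^ 2 / 2 + k * (f t * f1 t) + k ^ 2 / 2 * (f t ^ 2 / t) := by
    field_simp
    ring
  linarith

lemma lagW_le {k N : ℝ} (f f1 : ℝ → ℝ) {t : ℝ} (ht : 0 < t) :
    lagW k N f f1 t ≤
      t ^ k * (3 / 2 * t * f1 t ^ 2 + (N - t / 4) * f t ^ 2 + k ^ 2 * (f t ^ 2 / t)) := by
  unfold lagW
  refine mul_le_mul_of_nonneg_left ?_ (by positivity)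
  have : 0 ≤ (t * f1 t - k * f t) ^ 2 / (2 * t) := by positivity
  have e : (t * f1 t - k * f t) ^ 2 / (2 * t) =
    t * f1 t ^ 2 / 2 - k * (f t * f1 t) + k ^ 2 / 2 * (f t ^ 2 / t) := by
    field_simp
    ring
  linarith

lemma LagODE.W_init {b : ℕ} {N : ℝ} {f f1 f2 : ℝ → ℝ} (h : LagODE b N f f1 f2) {k : ℝ}
    (hN : 1 ≤ N) : lagW k N f f1 (1 / N) ≤ (1 / N) ^ k * ((3 / 2 + 2 * k ^ 2) * (N * f 0 ^ 2)) := by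
  have hN0 : 0 < N := by linarith
  refine (lagW_le f f1 (by positivity)).trans ?_
  refine mul_le_mul_of_nonneg_left ?_ (by positivity)
  have h1 := h.H (t := 1 / N) (by positivity)
  have h2 : 1 / N ≤ 1 := by rw [div_le_one hN0]; exact hN
  have h0 : 0 < 1 / N := by positivity
  set s := 1 / N with hs
  have h3 : f s ^ 2 / s = N * f s ^ 2 := by rw [hs]; field_simp
  rw [h3]
  have h4 : N / 2 * f s ^ 2 ≤ (N - s / 4) * f s ^ 2 := by
    apply mul_le_mul_of_nonneg_right _ (sq_nonneg _); linarith
  have h5 : 0 ≤ s * f1 s ^ 2 := by positivity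
  have h6 : N * f s ^ 2 ≤ 2 * (N * f 0 ^ 2) := by linarith
  have h7 : 0 ≤ N * f s ^ 2 := by positivity
  nlinarith [mul_le_mul_of_nonneg_left h6 (sq_nonneg k)]

lemma LagODE.W_bd {b : ℕ} {N : ℝ} {f f1 f2 : ℝ → ℝ} (h : LagODE b N f f1 f2) {k : ℝ}
    (hk : k = b + 1 / 4) (hN : 1 ≤ N) (hB : lagB b k ≤ N) {t : ℝ} (ht : 1 / N ≤ t)
    (ht' : t ≤ 4 * N) : lagW k N f f1 t ≤ Real.exp (2 * lagB b k) * lagW k N f f1 (1 / N) := by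
  have hN0 : 0 < N := by linarith
  have hk0 : 0 ≤ k := by rw [hk]; positivity
  set B := lagB b k with hBdef
  have hB0 : 0 ≤ B := by rw [hBdef]; unfold lagB; positivity
  have s0 : 0 < 1 / N := by positivity
  have hV : AntitoneOn (fun t => lagW k N f f1 t * Real.exp (2 * B / N * t⁻¹)) (Set.Icc (1 / N) (2 * N)) := by
    apply anti_aux (convex_Icc _ _)
      (g' := fun t => (lagW' b k f f1 t - 2 * B / N / t ^ 2 * lagW k N f f1 t) * Real.exp (2 * B / N * t⁻¹))
    · intro x hx
      have hx0 : 0 < x := s0.trans_le hx.1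
      have e := (h.hasDerivW hk hx0).mul (((hasDerivAt_inv hx0.ne').const_mul (2 * B / N)).exp)
      refine e.congr_deriv ?_
      ring
    · intro x hx
      have hx0 : 0 < x := s0.trans_le hx.1
      refine mul_nonpos_of_nonpos_of_nonneg ?_ (Real.exp_pos _).le
      have a1 := lagW'_le (b : ℝ) (k := k) f f1 hx0
      have a2 := lagW_ge (k := k) (N := N) f f1 hx0
      have a3 : x ^ k * (N / 2 * f x ^ 2) ≤ x ^ k * (x * f1 x ^ 2 / 2 + (N - x / 4) * f x ^ 2) := by
        refine mul_le_mul_of_nonneg_left ?_ (by positivity)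
        have : N / 2 * f x ^ 2 ≤ (N - x / 4) * f x ^ 2 := by
          apply mul_le_mul_of_nonneg_right _ (sq_nonneg _); linarith [hx.2]
        have : 0 ≤ x * f1 x ^ 2 / 2 := by positivity
        linarith
      have a4 : 2 * B / N / x ^ 2 * (x ^ k * (N / 2 * f x ^ 2)) ≤ 2 * B / N / x ^ 2 * lagW k N f f1 x :=
        mul_le_mul_of_nonneg_left (a3.trans a2) (by positivity)
      have a5 : 2 * B / N / x ^ 2 * (x ^ k * (N / 2 * f x ^ 2)) = x ^ k / x ^ 2 * (f x ^ 2 * B) := by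
        field_simp
      have a6 : x ^ k / x ^ 2 * (f x ^ 2 * (B - x ^ 2 / 4)) ≤ x ^ k / x ^ 2 * (f x ^ 2 * B) := by
        gcongr
        have := sq_nonneg x
        linarith
      linarith
  have hVb : ∀ s, 1 / N ≤ s → s ≤ 2 * N → 
      lagW k N f f1 s ≤ Real.exp (2 * B) * lagW k N f f1 (1 / N) := by
    intro s hs hs'
    have hs0 : 0 < s := s0.trans_le hs
    have := hV ⟨le_rfl, hs.trans hs'⟩ ⟨hs, hs'⟩ hs
    simp only at this
    have e : 2 * B / N * (1 / N)⁻¹ = 2 * B := by field_simp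
    rw [e] at this
    have w0 : 0 ≤ lagW k N f f1 s := by
      refine le_trans ?_ (lagW_ge f f1 hs0)
      have : 0 ≤ N - s / 4 := by linarith
      positivity
    have : lagW k N f f1 s * 1 ≤ lagW k N f f1 s * Real.exp (2 * B / N * s⁻¹) := by
      apply mul_le_mul_of_nonneg_left _ w0
      apply Real.one_le_exp
      positivity
    linarith
  have hNN : 1 / N ≤ 2 * N := by rw [div_le_iff₀ hN0]; nlinarith
  rcases le_total t (2 * N) with h2 | h2
  · exact hVb t ht h2
  · have hW : AntitoneOn (lagW k N f f1) (Set.Icc (2 * N) (4 * N)) := by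
      apply anti_aux (convex_Icc _ _) (g' := lagW' b k f f1)
      · intro x hx
        exact h.hasDerivW hk (by linarith [hx.1])
      · intro x hx
        have hx0 : 0 < x := by linarith [hx.1]
        refine (lagW'_le (b : ℝ) (k := k) f f1 hx0).trans ?_
        refine mul_nonpos_of_nonneg_of_nonpos (by positivity) ?_
        refine mul_nonpos_of_nonneg_of_nonpos (by positivity) ?_
        have : B ≤ N ^ 2 := by nlinarith
        nlinarith [hx.1]
    exact (hW ⟨le_rfl, by linarith⟩ ⟨h2, ht'⟩ h2).trans (hVb _ hNN le_rfl)

/-- mid-range bound on the derivative -/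
lemma LagODE.mid {b : ℕ} {N : ℝ} {f f1 f2 : ℝ → ℝ} (h : LagODE b N f f1 f2) {k : ℝ}
    (hk : k = b + 1 / 4) (hN : 1 ≤ N) (hB : lagB b k ≤ N) {t : ℝ} (ht : 1 / N ≤ t)
    (ht' : t ≤ 4 * N) : t ^ k * (t * f1 t ^ 2) ≤
      2 * Real.exp (2 * lagB b k) * (3 / 2 + 2 * k ^ 2) * (N ^ (1 - k) * f 0 ^ 2) := by
  have hN0 : 0 < N := by linarith
  have s0 : 0 < 1 / N := by positivity
  have t0 := s0.trans_le ht
  have a1 := h.W_bd hk hN hB ht ht'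
  have a2 := h.W_init (k := k) hN
  have a3 := lagW_ge (k := k) (N := N) f f1 t0
  have a4 : t ^ k * (t * f1 t ^ 2) / 2 ≤ t ^ k * (t * f1 t ^ 2 / 2 + (N - t / 4) * f t ^ 2) := by
    have : 0 ≤ (N - t / 4) := by linarith
    have : 0 ≤ t ^ k * ((N - t / 4) * f t ^ 2) := by positivity
    linarith
  have a5 := mul_le_mul_of_nonneg_left a2 (Real.exp_pos (2 * lagB b k)).le
  have e : (1 / N) ^ k * N = N ^ (1 - k) := by
    rw [Real.rpow_sub hN0, Real.rpow_one, one_div, Real.inv_rpow hN0.le]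
    field_simp
  rw [← e]
  linarith

lemma rpow_abs_aux {t N e : ℝ} (hN : 1 ≤ N) (ht : 1 / N ≤ t) (ht' : t ≤ 4 * N) :
    t ^ e ≤ 4 ^ |e| * N ^ |e| := by
  have hN0 : 0 < N := by linarith
  have s0 : 0 < 1 / N := by positivity
  have t0 := s0.trans_le ht
  rw [← Real.mul_rpow (by norm_num) hN0.le]
  rcases le_total 0 e with h | h
  · rw [abs_of_nonneg h]
    exact Real.rpow_le_rpow t0.le ht' h
  · rw [abs_of_nonpos h]
    calc t ^ e ≤ (1 / N) ^ e := Real.rpow_le_rpow_of_nonpos s0 ht h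
      _ = N ^ (-e) := by rw [one_div, Real.inv_rpow hN0.le, Real.rpow_neg hN0.le]
      _ ≤ (4 * N) ^ (-e) := Real.rpow_le_rpow hN0.le (by linarith) (by linarith)

lemma key_mid (d n : ℕ) (hn : n < d) (A : ℝ) : ∃ C : ℝ, 0 ≤ C ∧ ∀ (N : ℝ) (f f1 f2 : ℝ → ℝ),
    LagODE (d - 1 + n) N f f1 f2 → 1 ≤ N → 
    lagB ((d - 1 + n : ℕ) : ℝ) (((d - 1 + n : ℕ) : ℝ) + 1 / 4) ≤ N →
    f 0 ^ 2 ≤ A * N ^ (2 * (d - 1 + n)) → ∀ t, 0 < t → 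
    t ^ (2 * n + 2) * f1 t ^ 2 ≤ C * N ^ (2 * (d : ℝ) - 1 / 2) := by
  set b := d - 1 + n with hb
  set k : ℝ := (b : ℝ) + 1 / 4 with hk
  have hbr : (b : ℝ) = d - 1 + n := by
    rw [hb]; push_cast [Nat.cast_sub (show 1 ≤ d by omega)]; ring
  set K := 2 * Real.exp (2 * lagB b k) * (3 / 2 + 2 * k ^ 2) with hK
  have hK0 : 0 ≤ K := by positivity
  set e : ℝ := 2 * n + 1 - k with he
  refine ⟨4 ^ |e| * (K * |A|) + |A|, by positivity, ?_⟩
  intro N f f1 f2 h hN hB h0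
  have hN0 : 0 < N := by linarith
  have h0' : f 0 ^ 2 ≤ |A| * N ^ (2 * b) := h0.trans (by gcongr; exact le_abs_self A)
  have hA : 0 ≤ 4 ^ |e| * (K * |A|) * N ^ (2 * (d : ℝ) - 1 / 2) := by positivity
  have hA' : 0 ≤ |A| * N ^ (2 * (d : ℝ) - 1 / 2) := by positivity
  have near : ∀ t, 0 < t → t ≤ 4 * N → 
      t ^ (2 * n + 2) * f1 t ^ 2 ≤ (4 ^ |e| * (K * |A|) + |A|) * N ^ (2 * (d : ℝ) - 1 / 2) := by
    intro t ht ht'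
    rcases le_total t (1 / N) with h1 | h1
    · have a := h.H ht.le
      have a1 : t * f1 t ^ 2 ≤ N * (|A| * N ^ (2 * b)) := by
        have : 0 ≤ (N - t / 4) := by linarith
        have : 0 ≤ (N - t / 4) * f t ^ 2 := by positivity
        have := mul_le_mul_of_nonneg_left h0' hN0.le
        linarith
      have a2 : t ^ (2 * n + 1) ≤ (1 / N) ^ (2 * n + 1) := by gcongr
      have a3 : t ^ (2 * n + 2) * f1 t ^ 2 ≤ (1 / N) ^ (2 * n + 1) * (N * (|A| * N ^ (2 * b))) := by
        calc _ = t ^ (2 * n + 1) * (t * f1 t ^ 2) := by ring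
          _ ≤ _ := by gcongr
      have a4 : (1 / N) ^ (2 * n + 1) * (N * (|A| * N ^ (2 * b))) = |A| * N ^ (2 * (d : ℝ) - 2) := by
        have : N ^ (2 * (d : ℝ) - 2) = N ^ (2 * (d - 1)) := by
          rw [← Real.rpow_natCast]; congr 1
          push_cast [Nat.cast_sub (show 1 ≤ d by omega)]; ring
        rw [this, hb, mul_add, pow_add N, one_div, inv_pow, pow_succ]
        field_simp
      have a5 : |A| * N ^ (2 * (d : ℝ) - 2) ≤ |A| * N ^ (2 * (d : ℝ) - 1 / 2) := by
        gcongr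
        norm_num
      linarith
    · have a := h.mid hk hN hB h1 ht'
      have a1 : t ^ k * (t * f1 t ^ 2) ≤ K * (N ^ (1 - k) * (|A| * N ^ (2 * b))) :=
        a.trans (by gcongr)
      have a2 : t ^ (2 * n + 2) * f1 t ^ 2 = t ^ e * (t ^ k * (t * f1 t ^ 2)) := by
        rw [← mul_assoc, ← Real.rpow_add ht, he]
        have : (2 * (n : ℝ) + 1 - k + k) = ((2 * n + 1 : ℕ) : ℝ) := by push_cast; ring
        rw [this, Real.rpow_natCast]
        ring
      rw [a2]
      have a3 : t ^ e * (t ^ k * (t * f1 t ^ 2)) ≤ 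
          (4 ^ |e| * N ^ |e|) * (K * (N ^ (1 - k) * (|A| * N ^ (2 * b)))) := by
        gcongr
        exact rpow_abs_aux hN h1 ht'
      have a4 : (4 ^ |e| * N ^ |e|) * (K * (N ^ (1 - k) * (|A| * N ^ (2 * b)))) 
          = 4 ^ |e| * (K * |A|) * N ^ (|e| + (1 - k) + 2 * b) := by
        rw [Real.rpow_add hN0, Real.rpow_add hN0]
        have : N ^ (2 * (b : ℝ)) = N ^ (2 * b) := by
          rw [← Real.rpow_natCast]; push_cast; rfl
        rw [this]; ring
      have a5 : N ^ (|e| + (1 - k) + 2 * b) ≤ N ^ (2 * (d : ℝ) - 1 / 2) := by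
        apply Real.rpow_le_rpow_of_exponent_le hN
        have hnd : (n : ℝ) + 1 ≤ d := by exact_mod_cast hn
        rcases abs_cases e with ⟨q, _⟩ | ⟨q, _⟩ <;> rw [q, he, hk, hbr] <;> linarith
      have a6 : 4 ^ |e| * (K * |A|) * N ^ (|e| + (1 - k) + 2 * b) ≤ 
        4 ^ |e| * (K * |A|) * N ^ (2 * (d : ℝ) - 1 / 2) := by gcongr
      linarith
  intro t ht
  rcases le_total t (4 * N) with h1 | h1
  · exact near t ht h1
  · refine le_trans ?_ (near (4 * N) (by linarith) le_rfl)
    have a := h.far1 hN0 h1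
    obtain ⟨c, hc⟩ : ∃ c, b = n + c := ⟨d - 1, by omega⟩
    have a1 : (4 * N) ^ (2 * c) * (t ^ (2 * n + 2) * f1 t ^ 2) ≤ 
        (4 * N) ^ (2 * c) * ((4 * N) ^ (2 * n + 2) * f1 (4 * N) ^ 2) := by
      calc _ ≤ t ^ (2 * c) * (t ^ (2 * n + 2) * f1 t ^ 2) := by gcongr
        _ = t ^ (2 * b + 2) * f1 t ^ 2 := by rw [hc]; ring
        _ ≤ _ := a
        _ = _ := by rw [hc]; ring
    exact le_of_mul_le_mul_left a1 (by positivity)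

lemma key_zero (d : ℕ) (hd : 1 ≤ d) (A : ℝ) : ∃ C : ℝ, 0 ≤ C ∧ ∀ (N : ℝ) (f f1 f2 : ℝ → ℝ),
    LagODE (d - 1) N f f1 f2 → 1 ≤ N → 
    lagB ((d - 1 : ℕ) : ℝ) (((d - 1 : ℕ) : ℝ) + 1 / 4) ≤ N →
    f 0 ^ 2 ≤ A * N ^ (2 * (d - 1)) → ∀ t, 0 < t → 
    |f t| ≤ C * N ^ ((d : ℝ) - 1 / 4) := by
  set b := d - 1 with hb
  set k : ℝ := (b : ℝ) + 1 / 4 with hk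
  have hbr : (b : ℝ) = d - 1 := by
    rw [hb]; push_cast [Nat.cast_sub hd]; ring
  set K := 2 * Real.exp (2 * lagB b k) * (3 / 2 + 2 * k ^ 2) with hK
  have hK0 : 0 ≤ K := by positivity
  refine ⟨√(2 * |A|) + 2 * √(K * |A|), by positivity, ?_⟩
  intro N f f1 f2 h hN hB h0
  have hN0 : 0 < N := by linarith
  have h0' : f 0 ^ 2 ≤ |A| * N ^ (2 * b) := h0.trans (by gcongr; exact le_abs_self A)
  have hd1 : (1 : ℝ) ≤ d := by exact_mod_cast hd
  have hP : 0 ≤ 2 * √(K * |A|) * N ^ ((d : ℝ) - 1 / 4) := by positivity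
  have n1 : ∀ t, 0 < t → t ≤ 2 * N → |f t| ≤ √(2 * |A|) * N ^ ((d : ℝ) - 1 / 4) := by
    intro t ht ht'
    have a := h.H ht.le
    have a1 : N / 2 * f t ^ 2 ≤ (N - t / 4) * f t ^ 2 := by
      apply mul_le_mul_of_nonneg_right _ (sq_nonneg _); linarith
    have a2 : 0 ≤ t * f1 t ^ 2 := by positivity
    have a3 : N / 2 * f t ^ 2 ≤ N / 2 * (2 * (|A| * N ^ (2 * b))) := by
      have := mul_le_mul_of_nonneg_left h0' hN0.le
      linarith
    have a4 := le_of_mul_le_mul_left a3 (by positivity)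
    have a5 : |f t| ≤ √(2 * |A|) * N ^ b := by
      apply abs_le_of_sq_le_sq _ (by positivity)
      rw [mul_pow, Real.sq_sqrt (by positivity)]
      calc _ ≤ _ := a4
        _ = _ := by ring
    refine a5.trans ?_
    gcongr
    rw [← Real.rpow_natCast]
    apply Real.rpow_le_rpow_of_exponent_le hN
    rw [hbr]; linarith
  have dv : ∀ t ∈ Set.Icc (2 * N) (4 * N), |f1 t| ≤ √(K * |A|) * N ^ (-(1 / 4) : ℝ) := by
    intro t ht
    have hs : 1 / N ≤ t := by
      have : 1 / N ≤ 1 := by rw [div_le_one hN0]; exact hN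
      linarith [ht.1]
    have t0 : 0 < t := by linarith [ht.1]
    have a := h.mid hk hN hB hs ht.2
    have a1 : N ^ k * (N * f1 t ^ 2) ≤ t ^ k * (t * f1 t ^ 2) := by
      have : N ≤ t := by linarith [ht.1]
      have hk0 : 0 ≤ k := by positivity
      gcongr
    have a2 : N ^ (k + 1) * f1 t ^ 2 ≤ N ^ (k + 1) * (K * |A| * N ^ (-(1 / 2) : ℝ)) := by
      calc _ = N ^ k * (N * f1 t ^ 2) := by rw [Real.rpow_add_one hN0.ne']; ring
        _ ≤ K * (N ^ (1 - k) * f 0 ^ 2) := a1.trans a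
        _ ≤ K * (N ^ (1 - k) * (|A| * N ^ (2 * b))) := by gcongr
        _ = K * |A| * (N ^ (1 - k) * N ^ (2 * (b : ℝ))) := by
          have : N ^ (2 * (b : ℝ)) = N ^ (2 * b) := by
            rw [← Real.rpow_natCast]; push_cast; rfl
          rw [this]; ring
        _ = K * |A| * (N ^ (k + 1) * N ^ (-(1 / 2) : ℝ)) := by
          rw [← Real.rpow_add hN0, ← Real.rpow_add hN0]
          congr 2
          rw [hk]; ring
        _ = _ := by ring
    have a3 := le_of_mul_le_mul_left a2 (by positivity)
    apply abs_le_of_sq_le_sq _ (by positivity)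
    rw [mul_pow, Real.sq_sqrt (by positivity), ← Real.rpow_natCast (N ^ _), ← Real.rpow_mul hN0.le]
    refine a3.trans (le_of_eq ?_)
    norm_num
  have near : ∀ t, 0 < t → t ≤ 4 * N → 
      |f t| ≤ (√(2 * |A|) + 2 * √(K * |A|)) * N ^ ((d : ℝ) - 1 / 4) := by
    intro t ht ht'
    rcases le_total t (2 * N) with h1 | h1
    · linarith [n1 t ht h1]
    · have a := (convex_Icc (2 * N) (4 * N)).norm_image_sub_le_of_norm_hasDerivWithin_le
        (fun x _ => (h.h1 x).hasDerivWithinAt) dv (x := 2 * N) (y := t) ⟨le_rfl, by linarith⟩ ⟨h1, ht'⟩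
      have a1 := n1 (2 * N) (by linarith) le_rfl
      rw [Real.norm_eq_abs, Real.norm_eq_abs, abs_of_nonneg (by linarith : 0 ≤ t - 2 * N)] at a
      have a2 : √(K * |A|) * N ^ (-(1 / 4) : ℝ) * (t - 2 * N) ≤ 2 * √(K * |A|) * N ^ ((d : ℝ) - 1 / 4) := by
        calc _ ≤ √(K * |A|) * N ^ (-(1 / 4) : ℝ) * (2 * N) := by gcongr; linarith
          _ = 2 * √(K * |A|) * N ^ (-(1 / 4) + 1 : ℝ) := by rw [Real.rpow_add_one hN0.ne']; ring
          _ ≤ _ := by gcongr 2 * √(K * |A|) * ?_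
                      apply Real.rpow_le_rpow_of_exponent_le hN
                      linarith
      have a3 : |f t| ≤ |f (2 * N)| + |f t - f (2 * N)| := by
        have := abs_add_le (f (2 * N)) (f t - f (2 * N))
        simpa using this
      linarith
  intro t ht
  rcases le_total t (4 * N) with h1 | h1
  · exact near t ht h1
  · exact (sq_le_sq.1 (h.far0 hN0 h1)).trans (near (4 * N) (by linarith) le_rfl)

open Polynomial in
noncomputable def lagP (b m : ℕ) : ℝ[X] :=
  ∑ k ∈ Finset.range (m + 1),
    Polynomial.monomial k ((-1 : ℝ) ^ k * (Nat.choose (m + b) (b + k)) / (Nat.factorial k))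

lemma lagP_coeff (b m k : ℕ) : (lagP b m).coeff k =
    (-1 : ℝ) ^ k * (Nat.choose (m + b) (b + k)) / (Nat.factorial k) := by
  unfold lagP
  rw [Polynomial.finsetSum_coeff]
  simp only [Polynomial.coeff_monomial]
  rw [Finset.sum_ite_eq' (Finset.range (m + 1)) k]
  split_ifs with h
  · rfl
  · rw [Nat.choose_eq_zero_of_lt]
    · simp
    · simp at h; omega

lemma lagP_eval (b m : ℕ) (t : ℝ) : laguerreL b m t = (lagP b m).eval t := by
  unfold lagP laguerreL
  rw [Polynomial.eval_finsetSum]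
  refine Finset.sum_congr rfl fun k hk => ?_
  rw [Polynomial.eval_monomial]
  have : k ≤ m := by simp at hk; omega
  have h : Nat.choose (m + b) (m - k) = Nat.choose (m + b) (b + k) := by
    apply Nat.choose_symm_of_eq_add
    omega
  rw [h]; ring

open Polynomial in
lemma lagP_ode (b m : ℕ) : X * derivative (derivative (lagP b m)) + (C ((b : ℝ) + 1) - X) *
    derivative (lagP b m) + C (m : ℝ) * lagP b m = 0 := by
  ext k
  have key : ((k : ℝ) + 1) * (k + b + 1) * (lagP b m).coeff (k + 1) = (k - m) * (lagP b m).coeff k := by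
    rw [lagP_coeff, lagP_coeff]
    have h1 : (Nat.choose (m + b) (b + k + 1) : ℝ) * (b + k + 1) = Nat.choose (m + b) (b + k) * (m - k) := by
      rcases le_or_gt k m with h | h
      · have := Nat.choose_succ_right_eq (m + b) (b + k)
        have e : m + b - (b + k) = m - k := by omega
        rw [e] at this
        have := congrArg (Nat.cast : ℕ → ℝ) this
        push_cast [Nat.cast_sub h] at this
        exact this
      · rw [Nat.choose_eq_zero_of_lt (by omega), Nat.choose_eq_zero_of_lt (by omega)]
        simp
    rw [← add_assoc, Nat.factorial_succ, pow_succ]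
    push_cast
    have : (Nat.factorial k : ℝ) ≠ 0 := by positivity
    field_simp
    linear_combination (-1) * h1
  rw [sub_mul]
  simp only [coeff_add, coeff_sub, coeff_C_mul, coeff_zero]
  rcases k with _ | k
  · simp only [coeff_X_mul_zero, coeff_derivative]
    push_cast at key ⊢
    linear_combination key
  · simp only [coeff_X_mul, coeff_derivative]
    push_cast at key ⊢
    linear_combination key

open Polynomial in
noncomputable def Dp : ℝ[X] →ₗ[ℝ] ℝ[X] := derivative - (1 / 2 : ℝ) • LinearMap.id

open Polynomial in
lemma Dp_apply (P : ℝ[X]) : Dp P = derivative P - C (1 / 2 : ℝ) * P := by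
  simp [Dp, smul_eq_C_mul]

open Polynomial in
noncomputable def Tp : ℝ[X] →ₗ[ℝ] ℝ[X] := (LinearMap.mulLeft ℝ X) ∘ₗ Dp

open Polynomial in
lemma Tp_apply (P : ℝ[X]) : Tp P = X * Dp P := by
  simp [Tp]

open Polynomial in
lemma Dp_lagP (b m : ℕ) : Dp (lagP b (m + 1)) = 
    (-(1 / 2) : ℝ) • (lagP (b + 1) (m + 1) + lagP (b + 1) m) := by
  rw [Dp_apply]
  ext k
  simp only [coeff_sub, coeff_derivative, coeff_C_mul, coeff_smul, coeff_add, lagP_coeff, smul_eq_mul]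
  have e1 : m + 1 + (b + 1) = (m + b + 1) + 1 := by ring
  have e2 : b + 1 + k = (b + k) + 1 := by ring
  have e3 : m + (b + 1) = m + b + 1 := by ring
  have e4 : m + 1 + b = m + b + 1 := by ring
  rw [e1, e2, e3, e4, Nat.choose_succ_succ, ← add_assoc, Nat.factorial_succ, pow_succ]
  push_cast
  have : (Nat.factorial k : ℝ) ≠ 0 := by positivity
  field_simp
  ring

open Polynomial in
noncomputable def pe (P : ℝ[X]) (t : ℝ) : ℝ := P.eval t * Real.exp (-t / 2)

open Polynomial in
lemma pe_add (P Q : ℝ[X]) (t : ℝ) : pe (P + Q) t = pe P t + pe Q t := by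
  simp [pe]; ring

open Polynomial in
lemma pe_smul (c : ℝ) (Q : ℝ[X]) (t : ℝ) : pe (c • Q) t = c * pe Q t := by
  simp [pe]; ring

open Polynomial in
lemma pe_Xpow (n : ℕ) (Q : ℝ[X]) (t : ℝ) : pe (X ^ n * Q) t = t ^ n * pe Q t := by
  simp [pe]; ring

open Polynomial in
lemma pe_deriv (P : ℝ[X]) (t : ℝ) : HasDerivAt (pe P) (pe (Dp P) t) t := by
  have e := (P.hasDerivAt t).mul (((hasDerivAt_id t).neg.div_const 2).exp)
  refine e.congr_deriv ?_
  rw [Dp_apply]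
  simp [pe]
  ring

open Polynomial in
lemma tauD_pe (P : ℝ[X]) : tauD (pe P) = pe (Tp P) := by
  funext t
  rw [tauD, (pe_deriv P t).deriv, Tp_apply]
  simpa using (pe_Xpow 1 (Dp P) t).symm

open Polynomial in
lemma tauD_iter (n : ℕ) (P : ℝ[X]) : tauD^[n] (pe P) = pe ((Tp ^ n) P) := by
  induction n generalizing P with
  | zero => simp
  | succ n ih => rw [Function.iterate_succ_apply, tauD_pe, ih, pow_succ]; rfl

open Polynomial in
lemma pe_bdd (P : ℝ[X]) : ∃ C : ℝ, 0 ≤ C ∧ ∀ t, 0 < t → |pe P t| ≤ C := by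
  induction P using Polynomial.induction_on' with
  | add p q hp hq =>
    obtain ⟨C1, h1, h1'⟩ := hp
    obtain ⟨C2, h2, h2'⟩ := hq
    refine ⟨C1 + C2, by positivity, fun t ht => ?_⟩
    rw [pe_add]
    exact (abs_add_le _ _).trans (add_le_add (h1' t ht) (h2' t ht))
  | monomial n a =>
    refine ⟨|a| * (2 ^ n * Nat.factorial n), by positivity, fun t ht => ?_⟩
    have h := Real.pow_div_factorial_le_exp (t / 2) (by positivity) n
    rw [pe, eval_monomial, abs_mul, abs_mul, abs_of_pos (Real.exp_pos _), abs_of_nonneg (by positivity : 0 ≤ t ^ n), mul_assoc]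
    refine mul_le_mul_of_nonneg_left ?_ (abs_nonneg a)
    rw [neg_div, Real.exp_neg, ← div_eq_mul_inv, div_le_iff₀ (Real.exp_pos _)]
    rw [div_pow, div_div, div_le_iff₀ (by positivity)] at h
    linarith

open Polynomial in
lemma pe_LagODE (b m : ℕ) : LagODE b (m + ((b : ℝ) + 1) / 2) (pe (lagP b m)) (pe (Dp (lagP b m)))
    (pe (Dp (Dp (lagP b m)))) := by
  refine ⟨pe_deriv _, pe_deriv _, ?_, ?_⟩
  · intro t
    have h := congrArg (eval t) (lagP_ode b m)
    simp only [eval_add, eval_mul, eval_X, eval_sub, eval_C, eval_zero] at h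
    simp only [Dp_apply, pe, eval_mul, eval_sub, eval_C, derivative_sub, derivative_mul, derivative_C, zero_mul, zero_add]
    linear_combination (Real.exp (-t / 2)) * h
  · have := (X ^ (b + 1) * lagP b m * Dp (lagP b m)).tendsto_div_exp_atTop
    refine this.congr fun t => ?_
    simp only [pe, eval_mul, eval_pow, eval_X]
    have : Real.exp t = (Real.exp (-t / 2) * Real.exp (-t / 2))⁻¹ := by
      rw [← Real.exp_add, ← Real.exp_neg]; congr 1; ring
    rw [this, div_inv_eq_mul]
    ring

lemma pe_zero_sq (b m : ℕ) : pe (lagP b m) 0 ^ 2 ≤ (4 : ℝ) ^ b * (m + ((b : ℝ) + 1) / 2) ^ (2 * b) := by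
  have : pe (lagP b m) 0 = Nat.choose (m + b) b := by
    simp [pe, ← Polynomial.coeff_zero_eq_eval_zero, lagP_coeff]
  rw [this]
  have h1 : (Nat.choose (m + b) b : ℝ) ≤ ((m + b : ℕ) : ℝ) ^ b := by
    exact_mod_cast Nat.choose_le_pow (m + b) b
  have h2 : ((m + b : ℕ) : ℝ) ≤ 2 * (m + ((b : ℝ) + 1) / 2) := by
    push_cast
    have : (0 : ℝ) ≤ m := by positivity
    linarith
  calc _ ≤ ((2 * (m + ((b : ℝ) + 1) / 2)) ^ b) ^ 2 := by
        gcongr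
        exact h1.trans (by gcongr)
    _ = _ := by
      rw [← pow_mul, mul_pow, mul_comm b 2, pow_mul (2 : ℝ)]
      norm_num

open Polynomial in
def SB (e : ℝ) (Q : ℕ → ℝ[X]) : Prop :=
  ∃ (C : ℝ) (M : ℕ), 0 ≤ C ∧ ∀ m, M ≤ m → ∀ t, 0 < t → |pe (Q m) t| ≤ C * ((m : ℝ) + 1) ^ e

open Polynomial in
lemma SB.add {e : ℝ} {Q R : ℕ → ℝ[X]} (hQ : SB e Q) (hR : SB e R) : SB e (fun m => Q m + R m) := by
  obtain ⟨C, M, hC, h⟩ := hQ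
  obtain ⟨C', M', hC', h'⟩ := hR
  refine ⟨C + C', max M M', by positivity, fun m hm t ht => ?_⟩
  rw [pe_add, add_mul]
  exact (abs_add_le _ _).trans (add_le_add (h m (le_of_max_le_left hm) t ht)
    (h' m (le_of_max_le_right hm) t ht))

open Polynomial in
lemma SB.smul {e : ℝ} {Q : ℕ → ℝ[X]} (hQ : SB e Q) (c : ℝ) : SB e (fun m => c • Q m) := by
  obtain ⟨C, M, hC, h⟩ := hQ
  refine ⟨|c| * C, M, by positivity, fun m hm t ht => ?_⟩
  rw [pe_smul, abs_mul, mul_assoc]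
  exact mul_le_mul_of_nonneg_left (h m hm t ht) (abs_nonneg c)

open Polynomial in
lemma SB.shift {e : ℝ} (he : 0 ≤ e) {Q : ℕ → ℝ[X]} (hQ : SB e Q) : SB e (fun m => Q (m - 1)) := by
  obtain ⟨C, M, hC, h⟩ := hQ
  refine ⟨C, M + 1, by positivity, fun m hm t ht => ?_⟩
  refine (h (m - 1) (by omega) t ht).trans ?_
  gcongr
  omega

open Polynomial in
lemma SB.congr {e : ℝ} {Q R : ℕ → ℝ[X]} (hQ : SB e Q) (hR : ∀ m, 1 ≤ m → R m = Q m) : SB e R := by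
  obtain ⟨C, M, hC, h⟩ := hQ
  refine ⟨C, M + 1, by positivity, fun m hm t ht => ?_⟩
  rw [hR m (by omega)]
  exact h m (by omega) t ht

lemma N_le (b m : ℕ) : (m + ((b : ℝ) + 1) / 2) ≤ ((b : ℝ) + 1) * (m + 1) := by
  have : (0 : ℝ) ≤ m := by positivity
  have : (0 : ℝ) ≤ b := by positivity
  nlinarith [mul_nonneg ‹(0 : ℝ) ≤ m› this]

lemma N_ge (b m : ℕ) {x : ℝ} (hm : max 1 ⌈x⌉₊ ≤ m) :
    1 ≤ (m + ((b : ℝ) + 1) / 2) ∧ x ≤ (m + ((b : ℝ) + 1) / 2) := by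
  have h1 : (1 : ℝ) ≤ m := by exact_mod_cast le_of_max_le_left hm
  have h2 : x ≤ m := Nat.ceil_le.1 (le_of_max_le_right hm)
  have : (0 : ℝ) ≤ b := by positivity
  constructor <;> linarith

open Polynomial in
lemma SB_base (d n : ℕ) (hn : n < d) : 
    SB ((d : ℝ) - 1 / 4) (fun m => X ^ (n + 1) * Dp (lagP (d - 1 + n) m)) := by
  obtain ⟨C, hC, h⟩ := key_mid d n hn (4 ^ (d - 1 + n))
  set b := d - 1 + n with hb
  have hd1 : (1 : ℝ) ≤ d := by exact_mod_cast (show 1 ≤ d by omega)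
  refine ⟨√C * ((b : ℝ) + 1) ^ ((d : ℝ) - 1 / 4), max 1 ⌈lagB b ((b : ℝ) + 1 / 4)⌉₊, by positivity, ?_⟩
  intro m hm t ht
  obtain ⟨h1, h2⟩ := N_ge b m hm
  have a := h _ _ _ _ (pe_LagODE b m) h1 h2 (pe_zero_sq b m) t ht
  have hN0 : 0 < (m + ((b : ℝ) + 1) / 2) := by linarith
  rw [pe_Xpow]
  have a1 : |t ^ (n + 1) * pe (Dp (lagP b m)) t| ≤ √C * (m + ((b : ℝ) + 1) / 2) ^ ((d : ℝ) - 1 / 4) := by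
    apply abs_le_of_sq_le_sq _ (by positivity)
    rw [mul_pow (√C), Real.sq_sqrt hC, ← Real.rpow_natCast (_ ^ ((d : ℝ) - 1 / 4)), ← Real.rpow_mul hN0.le]
    calc _ = _ := by ring
      _ ≤ _ := a
      _ = _ := by congr 2; push_cast; ring
  refine a1.trans ?_
  rw [mul_assoc, ← Real.mul_rpow (by positivity) (by positivity)]
  gcongr
  · linarith
  · exact N_le b m

open Polynomial in
lemma SB_zero (d : ℕ) (hd : 1 ≤ d) : SB ((d : ℝ) - 1 / 4) (fun m => lagP (d - 1) m) := by
  obtain ⟨C, hC, h⟩ := key_zero d hd (4 ^ (d - 1))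
  set b := d - 1 with hb
  have hd1 : (1 : ℝ) ≤ d := by exact_mod_cast hd
  refine ⟨C * ((b : ℝ) + 1) ^ ((d : ℝ) - 1 / 4), max 1 ⌈lagB b ((b : ℝ) + 1 / 4)⌉₊, by positivity, ?_⟩
  intro m hm t ht
  obtain ⟨h1, h2⟩ := N_ge b m hm
  have a := h _ _ _ _ (pe_LagODE b m) h1 h2 (pe_zero_sq b m) t ht
  refine a.trans ?_
  rw [mul_assoc, ← Real.mul_rpow (by positivity) (by positivity)]
  gcongr
  · linarith
  · exact N_le b m

open Polynomial in
lemma SB_chain (d n : ℕ) (hn : n < d) (i a : ℕ) (ha : a + i = d - 1 + n) :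
    SB ((d : ℝ) - 1 / 4) (fun m => X ^ (n + 1) * (Dp ^ (i + 1)) (lagP a m)) := by
  have hd1 : (1 : ℝ) ≤ d := by exact_mod_cast (show 1 ≤ d by omega)
  induction i generalizing a with
  | zero =>
    have := SB_base d n hn
    rw [← ha] at this
    simpa using this
  | succ i ih =>
    have h := ih (a + 1) (by omega)
    have h' := ((h.add (h.shift (by linarith))).smul (-(1 / 2)))
    refine h'.congr fun m hm => ?_
    obtain ⟨m, rfl⟩ : ∃ k, m = k + 1 := ⟨m - 1, by omega⟩
    rw [pow_succ Dp (i + 1), Module.End.mul_apply, Dp_lagP, map_smul, map_add, Nat.add_sub_cancel,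
      mul_smul_comm, mul_add]

open Polynomial in
lemma SB_T (d : ℕ) (i j : ℕ) (hij : i + (j + 1) ≤ d) :
    SB ((d : ℝ) - 1 / 4) (fun m => (Tp ^ i) (X ^ (j + 1) * (Dp ^ (j + 1)) (lagP (d - 1) m))) := by
  induction i generalizing j with
  | zero => simpa using SB_chain d j (by omega) j (d - 1) rfl
  | succ i ih =>
    have h := ((ih j (by omega)).smul ((j : ℝ) + 1)).add (ih (j + 1) (by omega))
    refine h.congr fun m _ => ?_
    rw [pow_succ Tp, Module.End.mul_apply, ← map_smul, ← map_add]
    congr 1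
    rw [pow_succ' Dp (j + 1), Module.End.mul_apply]
    generalize (Dp ^ (j + 1)) (lagP (d - 1) m) = Q
    rw [Tp_apply, Dp_apply, Dp_apply, derivative_mul, derivative_X_pow, smul_eq_C_mul]
    simp only [Nat.cast_add, Nat.cast_one, C_add, C_1, map_natCast, Nat.add_sub_cancel]
    ring

open Polynomial in
lemma SB_main (d : ℕ) (hd : 1 ≤ d) (α : ℕ) (hα : α ≤ d) :
    SB ((d : ℝ) - 1 / 4) (fun m => (Tp ^ α) (lagP (d - 1) m)) := by
  rcases α with _ | α
  · simpa using SB_zero d hd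
  · have := SB_T d α 0 (by omega)
    refine this.congr fun m _ => ?_
    rw [pow_succ Tp, Module.End.mul_apply, Tp_apply]
    simp

/-- Estimate for the Laguerre functions: for `0 ≤ α ≤ d`,
`|(τ d/dτ)^α (L_m^{(d-1)}(τ) e^{-τ/2})| ≤ C_{α,d} (2m+d)^{d-1/4}`. -/
theorem statement4 (d : ℕ) (hd : 1 ≤ d) (α : ℕ) (hα : α ≤ d) :
    ∃ C : ℝ, 0 < C ∧ ∀ (m : ℕ) (τ : ℝ), 0 < τ →
      |tauD^[α] (fun τ => laguerreL (d - 1) m τ * Real.exp (-τ / 2)) τ| ≤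
        C * (2 * (m : ℝ) + d) ^ ((d : ℝ) - 1 / 4) := by
  obtain ⟨C, M, hC, h⟩ := SB_main d hd α hα
  choose c hc hc' using fun m => pe_bdd ((Tp ^ α) (lagP (d - 1) m))
  have hd1 : (1 : ℝ) ≤ d := by exact_mod_cast hd
  have hS : 0 ≤ ∑ m ∈ Finset.range M, c m := Finset.sum_nonneg fun m _ => hc m
  refine ⟨C + ∑ m ∈ Finset.range M, c m + 1, by positivity, ?_⟩
  intro m τ hτ
  have e : (fun τ => laguerreL (d - 1) m τ * Real.exp (-τ / 2)) = pe (lagP (d - 1) m) := by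
    funext t
    rw [lagP_eval, pe]
  rw [e, tauD_iter]
  have hm0 : (0 : ℝ) ≤ m := by positivity
  have p1 : 1 ≤ (2 * (m : ℝ) + d) ^ ((d : ℝ) - 1 / 4) :=
    Real.one_le_rpow (by linarith) (by linarith)
  have p2 : ((m : ℝ) + 1) ^ ((d : ℝ) - 1 / 4) ≤ (2 * (m : ℝ) + d) ^ ((d : ℝ) - 1 / 4) :=
    Real.rpow_le_rpow (by linarith) (by linarith) (by linarith)
  rcases le_or_gt M m with hm | hm
  · have := h m hm τ hτ
    have := mul_le_mul_of_nonneg_left p2 hC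
    nlinarith
  · have h1 := hc' m τ hτ
    have h2 : c m ≤ ∑ m ∈ Finset.range M, c m :=
      Finset.single_le_sum (fun i _ => hc i) (Finset.mem_range.2 hm)
    nlinarith
end
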